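/- Let u ∈ (−1, 0) and λ ∈ ℝ. Then there exists a constant c_u > 0 such that for every function v of the form v(x) = (1+x²)^{−(1+iλ)/2} Φ(e^{2iθ(x)}) with Φ : S¹ → ℂ smooth and θ(x) = arccot(x) ∈ (0,π) (i.e. every smooth vector of the spherical principal series P(iλ,+)^∞ in the noncompact picture): ⫴v⫴²_u := ∫₀^{2π} ∫_ℝ |ξ|^{−u} |𝓕(π_{iλ,+}(k_{θ₀}) v)(ξ)|² dξ dθ₀ ≤ c_u ∫_ℝ |ξ|^{−u} |𝓕( (1+x²)^{(iλ−u)/2} v(x) )(ξ)|² dξ, as an inequality in [0,∞]. -/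

import Mathlib

open MeasureTheory Real Set Filter Complex
open scoped ENNReal NNReal

noncomputable section

/-- The weight-`2m` K-type vector `v_{2m}^{(u)}(x) = (1+x²)^{−(1+u)/2} ((1+xi)/(1−xi))^m`
of the principal series `P(u,+)` in the noncompact picture. -/
def vEven (u : ℂ) (m : ℤ) (x : ℝ) : ℂ :=
  ((1 + x ^ 2 : ℝ) : ℂ) ^ (-(1 + u) / 2) *
    ((1 + (x : ℂ) * Complex.I) / (1 - (x : ℂ) * Complex.I)) ^ m

/-- `z` is the improper Fourier transform of `g` at `ξ`:
`z = lim_{R→∞} ∫_{−R}^R g(x) e^{−2πixξ} dx`. -/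
def IsImpFT (g : ℝ → ℂ) (ξ : ℝ) (z : ℂ) : Prop :=
  Filter.Tendsto
    (fun R : ℝ => ∫ x in Set.Ioc (-R) R,
      g x * Complex.exp (-2 * (Real.pi : ℂ) * Complex.I * (x : ℂ) * (ξ : ℂ)))
    Filter.atTop (nhds z)

/-- The principal-series rotation action
`(π_{s,+}(k_θ)v)(x) = |cos θ − x sin θ|^{−1−s} v((x cos θ + sin θ)/(cos θ − x sin θ))`. -/
def piPlus (s : ℂ) (θ : ℝ) (v : ℝ → ℂ) (x : ℝ) : ℂ :=
  ((|Real.cos θ - x * Real.sin θ| : ℝ) : ℂ) ^ (-1 - s) *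
    v ((x * Real.cos θ + Real.sin θ) / (Real.cos θ - x * Real.sin θ))

/-- The nonspherical principal-series rotation action, with the sign factor
`sgn(cos θ − x sin θ)`. -/
def piMinus (s : ℂ) (θ : ℝ) (v : ℝ → ℂ) (x : ℝ) : ℂ :=
  ((Real.sign (Real.cos θ - x * Real.sin θ) : ℝ) : ℂ) *
    ((|Real.cos θ - x * Real.sin θ| : ℝ) : ℂ) ^ (-1 - s) *
    v ((x * Real.cos θ + Real.sin θ) / (Real.cos θ - x * Real.sin θ))

/-- `arccot x = π/2 − arctan x ∈ (0, π)`. -/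
def arccot (x : ℝ) : ℝ := Real.pi / 2 - Real.arctan x

section

open scoped FourierTransform ComplexConjugate

/-- The vector of the principal series `P(a - 1)` with compact-picture profile `k`, in the
coordinate `t = arctan x`. -/
def confVec (a : ℂ) (k : ℝ → ℂ) (x : ℝ) : ℂ :=
  ((1 + x ^ 2 : ℝ) : ℂ) ^ (-a / 2) * k (Real.arctan x)

/-- The compact-picture profile of the derivative of `confVec a k`, where `k'` is the derivative
of `k`. -/
def derivProfile (a : ℂ) (k k' : ℝ → ℂ) (t : ℝ) : ℂ :=
  -a * Real.sin t * k t + Real.cos t * k' t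

theorem norm_one_add_sq_cpow (a : ℂ) (x : ℝ) :
    ‖((1 + x ^ 2 : ℝ) : ℂ) ^ (-a / 2)‖ = (1 + x ^ 2) ^ (-a.re / 2) := by
  rw [Complex.norm_cpow_eq_rpow_re_of_pos (by positivity)]
  congr 1
  simp

theorem norm_confVec (a : ℂ) (k : ℝ → ℂ) (x : ℝ) :
    ‖confVec a k x‖ = (1 + x ^ 2) ^ (-a.re / 2) * ‖k (Real.arctan x)‖ := by
  rw [confVec, norm_mul, norm_one_add_sq_cpow]

theorem norm_confVec_le (a : ℂ) {k : ℝ → ℂ} {B : ℝ} (hk : ∀ t, ‖k t‖ ≤ B) (x : ℝ) :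
    ‖confVec a k x‖ ≤ B * (1 + x ^ 2) ^ (-a.re / 2) := by
  rw [norm_confVec, mul_comm]
  gcongr
  exact hk _

theorem continuous_one_add_sq_cpow (a : ℂ) :
    Continuous fun x : ℝ => ((1 + x ^ 2 : ℝ) : ℂ) ^ (-a / 2) := by
  refine Continuous.cpow (by fun_prop) continuous_const fun x => ?_
  exact Complex.ofReal_mem_slitPlane.2 (by positivity)

theorem continuous_confVec (a : ℂ) {k : ℝ → ℂ} (hk : Continuous k) :
    Continuous (confVec a k) :=
  (continuous_one_add_sq_cpow a).mul (hk.comp Real.continuous_arctan)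

theorem continuous_derivProfile (a : ℂ) {k k' : ℝ → ℂ} (hk : Continuous k) (hk' : Continuous k') :
    Continuous (derivProfile a k k') := by
  unfold derivProfile
  fun_prop

theorem norm_derivProfile_le (a : ℂ) {k k' : ℝ → ℂ} {B B' : ℝ} (hk : ∀ t, ‖k t‖ ≤ B)
    (hk' : ∀ t, ‖k' t‖ ≤ B') (t : ℝ) : ‖derivProfile a k k' t‖ ≤ ‖a‖ * B + B' := by
  have hB : 0 ≤ B := (norm_nonneg _).trans (hk t)
  refine (norm_add_le _ _).trans (add_le_add ?_ ?_)
  · rw [norm_mul, norm_mul, norm_neg, Complex.norm_real, Real.norm_eq_abs]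
    calc ‖a‖ * |Real.sin t| * ‖k t‖ ≤ ‖a‖ * 1 * B := by
          gcongr
          · exact Real.abs_sin_le_one t
          · exact hk t
      _ = ‖a‖ * B := by ring
  · rw [norm_mul, Complex.norm_real, Real.norm_eq_abs]
    calc |Real.cos t| * ‖k' t‖ ≤ 1 * B' := by
          gcongr
          · exact Real.abs_cos_le_one t
          · exact hk' t
      _ = B' := one_mul _

theorem one_add_sq_cpow_half (x : ℝ) (a : ℂ) :
    ((1 + x ^ 2 : ℝ) : ℂ) ^ (-a / 2 - 1) =
      ((1 + x ^ 2 : ℝ) : ℂ) ^ (-(a + 1) / 2) * (((√(1 + x ^ 2))⁻¹ : ℝ) : ℂ) := by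
  have h0 : ((1 + x ^ 2 : ℝ) : ℂ) ≠ 0 := by
    exact_mod_cast (by positivity : (1 + x ^ 2 : ℝ) ≠ 0)
  have : (((√(1 + x ^ 2))⁻¹ : ℝ) : ℂ) = ((1 + x ^ 2 : ℝ) : ℂ) ^ (-(1 / 2) : ℂ) := by
    rw [Real.sqrt_eq_rpow, ← Real.rpow_neg (by positivity), Complex.ofReal_cpow (by positivity)]
    simp
  rw [this, ← Complex.cpow_add _ _ h0]
  congr 1
  ring

theorem hasDerivAt_confVec (a : ℂ) {k k' : ℝ → ℂ} (hk : ∀ t, HasDerivAt k (k' t) t) (x : ℝ) :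
    HasDerivAt (confVec a k) (confVec (a + 1) (derivProfile a k k') x) x := by
  have h1 : HasDerivAt (fun x : ℝ => ((1 + x ^ 2 : ℝ) : ℂ)) ((2 * x : ℝ) : ℂ) x := by
    refine HasDerivAt.ofReal_comp ?_
    simpa using (hasDerivAt_pow 2 x).const_add 1
  have h5 : ((1 + x ^ 2 : ℝ) : ℂ) ∈ slitPlane := Complex.ofReal_mem_slitPlane.2 (by positivity)
  have h2 := (Complex.hasStrictDerivAt_cpow_const (c := -a / 2) h5).hasDerivAt.comp x h1
  have h3 := (hk (Real.arctan x)).scomp x (Real.hasDerivAt_arctan x)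
  refine (h2.mul h3).congr_deriv ?_
  have h0 : ((1 + x ^ 2 : ℝ) : ℂ) ≠ 0 := by
    exact_mod_cast (by positivity : (1 + x ^ 2 : ℝ) ≠ 0)
  have h4 : ((1 + x ^ 2 : ℝ) : ℂ) ^ (-a / 2) = ((1 + x ^ 2 : ℝ) : ℂ) ^ (-a / 2 - 1) *
      ((1 + x ^ 2 : ℝ) : ℂ) := by
    rw [Complex.cpow_sub _ _ h0, Complex.cpow_one, div_mul_cancel₀ _ h0]
  simp only [Function.comp, Complex.real_smul, one_div]
  rw [confVec, derivProfile, h4, one_add_sq_cpow_half, Real.sin_arctan, Real.cos_arctan,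
    Complex.ofReal_inv (1 + x ^ 2), Complex.ofReal_div, one_div, Complex.ofReal_inv (√(1 + x ^ 2)),
    Complex.ofReal_mul]
  have h6 : (√(1 + x ^ 2) : ℂ) ≠ 0 := by
    exact_mod_cast (by positivity : √(1 + x ^ 2) ≠ 0)
  generalize (√(1 + x ^ 2) : ℂ) = y at *
  generalize ((1 + x ^ 2 : ℝ) : ℂ) = z at *
  push_cast
  field_simp

theorem integrable_one_add_sq_rpow {r : ℝ} (hr : 1 < r) :
    Integrable fun x : ℝ => (1 + x ^ 2) ^ (-r / 2) := by
  have := integrable_rpow_neg_one_add_norm_sq (E := ℝ) (μ := volume) (r := r) (by simpa using hr)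
  simpa using this

theorem integrable_confVec {a : ℂ} (ha : 1 < a.re) {k : ℝ → ℂ} (hk : Continuous k) {B : ℝ}
    (hB : ∀ t, ‖k t‖ ≤ B) : Integrable (confVec a k) :=
  ((integrable_one_add_sq_rpow ha).const_mul B).mono'
    (continuous_confVec a hk).aestronglyMeasurable
    (Eventually.of_forall fun x => norm_confVec_le a hB x)

theorem tendsto_one_add_sq_rpow {r : ℝ} (hr : 0 < r) :
    Tendsto (fun x : ℝ => (1 + x ^ 2) ^ (-r / 2)) atTop (nhds 0) := by
  have h1 : Tendsto (fun x : ℝ => 1 + x ^ 2) atTop atTop :=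
    tendsto_atTop_add_const_left _ _ (tendsto_pow_atTop two_ne_zero)
  have := (tendsto_rpow_neg_atTop (half_pos hr)).comp h1
  refine this.congr fun x => ?_
  simp [neg_div]

/-- The character `x ↦ e^{-2πixξ}`. -/
def ftKernel (ξ x : ℝ) : ℂ :=
  Complex.exp (-2 * (Real.pi : ℂ) * Complex.I * (x : ℂ) * (ξ : ℂ))

theorem norm_ftKernel (ξ x : ℝ) : ‖ftKernel ξ x‖ = 1 := by
  rw [ftKernel, Complex.norm_exp]
  simp

theorem continuous_ftKernel (ξ : ℝ) : Continuous (ftKernel ξ) := by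
  unfold ftKernel
  fun_prop

theorem hasDerivAt_ftKernel (ξ x : ℝ) :
    HasDerivAt (ftKernel ξ) (-(2 * π * I * ξ) * ftKernel ξ x) x := by
  have h : HasDerivAt (fun y : ℝ => -2 * (Real.pi : ℂ) * Complex.I * (y : ℂ) * (ξ : ℂ))
      (-2 * (Real.pi : ℂ) * Complex.I * 1 * (ξ : ℂ)) x :=
    ((Complex.ofRealCLM.hasDerivAt (x := x)).const_mul _).mul_const _
  refine h.cexp.congr_deriv ?_
  rw [ftKernel]
  ring

theorem fourier_eq_integral_ftKernel (f : ℝ → ℂ) (ξ : ℝ) :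
    𝓕 f ξ = ∫ x, f x * ftKernel ξ x := by
  rw [Real.fourier_real_eq_integral_exp_smul]
  refine integral_congr_ae (Eventually.of_forall fun x => ?_)
  simp only [smul_eq_mul, ftKernel]
  rw [mul_comm]
  congr 2
  push_cast
  ring

theorem fourier_indicator (f : ℝ → ℂ) {s : Set ℝ} (hs : MeasurableSet s) (ξ : ℝ) :
    𝓕 (s.indicator f) ξ = ∫ x in s, f x * ftKernel ξ x := by
  rw [fourier_eq_integral_ftKernel, ← integral_indicator hs]
  congr 1 with x
  by_cases hx : x ∈ s <;> simp [hx]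

theorem continuous_fourier {f : ℝ → ℂ} (hf : Integrable f) : Continuous (𝓕 f) :=
  VectorFourier.fourierIntegral_continuous Real.continuous_fourierChar
    (by fun_prop) hf

theorem norm_fourier_le (f : ℝ → ℂ) (ξ : ℝ) : ‖𝓕 f ξ‖ ≤ ∫ x, ‖f x‖ :=
  VectorFourier.norm_fourierIntegral_le_integral_norm _ _ _ _ _

theorem two_pi_I_mul_ne_zero {ξ : ℝ} (hξ : ξ ≠ 0) : (2 * π * I * ξ : ℂ) ≠ 0 := by
  simp [hξ, Real.pi_ne_zero]

theorem norm_two_pi_I_mul (ξ : ℝ) : ‖(2 * π * I * ξ : ℂ)‖ = 2 * π * |ξ| := by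
  simp [abs_of_pos Real.pi_pos]

/-- Integration by parts against the Fourier kernel. -/
theorem intervalIntegral_mul_ftKernel {f f' : ℝ → ℂ} (hf : ∀ x, HasDerivAt f (f' x) x)
    (hf' : Continuous f') {ξ : ℝ} (hξ : ξ ≠ 0) (a b : ℝ) :
    ∫ x in a..b, f x * ftKernel ξ x =
      (f a * ftKernel ξ a - f b * ftKernel ξ b + ∫ x in a..b, f' x * ftKernel ξ x) /
        (2 * π * I * ξ) := by
  have hfc : Continuous f := continuous_iff_continuousAt.2 fun x => (hf x).continuousAt
  have hk := continuous_ftKernel ξ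
  have h := intervalIntegral.integral_eq_sub_of_hasDerivAt (a := a) (b := b)
    (fun x _ => (hf x).mul (hasDerivAt_ftKernel ξ x))
    (Continuous.intervalIntegrable (by fun_prop) _ _)
  rw [intervalIntegral.integral_add (Continuous.intervalIntegrable (by fun_prop) _ _)
    (Continuous.intervalIntegrable (by fun_prop) _ _)] at h
  have h2 : ∫ x in a..b, f x * (-(2 * π * I * ξ) * ftKernel ξ x) =
      -(2 * π * I * ξ) * ∫ x in a..b, f x * ftKernel ξ x := by
    rw [← intervalIntegral.integral_const_mul]
    congr 1 with x
    ring
  rw [h2] at h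
  rw [eq_div_iff (two_pi_I_mul_ne_zero hξ)]
  simp only [Pi.mul_apply] at h
  linear_combination -h

theorem norm_intervalIntegral_mul_ftKernel_le {f f' : ℝ → ℂ} (hf : ∀ x, HasDerivAt f (f' x) x)
    (hf' : Continuous f') {ξ : ℝ} (hξ : ξ ≠ 0) {a b : ℝ} (hab : a ≤ b) :
    ‖∫ x in a..b, f x * ftKernel ξ x‖ ≤
      (‖f a‖ + ‖f b‖ + ∫ x in a..b, ‖f' x‖) / (2 * π * |ξ|) := by
  rw [intervalIntegral_mul_ftKernel hf hf' hξ, norm_div, norm_two_pi_I_mul]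
  gcongr
  refine (norm_add_le _ _).trans (add_le_add ((norm_sub_le _ _).trans ?_) ?_)
  · simp [norm_ftKernel]
  · refine (intervalIntegral.norm_integral_le_integral_norm hab).trans (le_of_eq ?_)
    simp [norm_ftKernel]

/-- The improper Fourier transform of a function with derivative `f'`, for `ξ ≠ 0`. -/
def impFT (f' : ℝ → ℂ) (ξ : ℝ) : ℂ := 𝓕 f' ξ / (2 * π * I * ξ)

theorem measurable_impFT {f' : ℝ → ℂ} (hf' : Integrable f') : Measurable (impFT f') :=
  (continuous_fourier hf').measurable.div (by fun_prop)

theorem isImpFT_impFT {f f' : ℝ → ℂ} (hf : ∀ x, HasDerivAt f (f' x) x) (hf' : Continuous f')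
    (hi : Integrable f') (htop : Tendsto f atTop (nhds 0)) (hbot : Tendsto f atBot (nhds 0))
    {ξ : ℝ} (hξ : ξ ≠ 0) : IsImpFT f ξ (impFT f' ξ) := by
  have hb : ∀ l : Filter ℝ, ∀ m : ℝ → ℝ, Tendsto (fun R => f (m R)) l (nhds 0) →
      Tendsto (fun R => f (m R) * ftKernel ξ (m R)) l (nhds 0) := by
    intro l m h
    rw [tendsto_zero_iff_norm_tendsto_zero] at h ⊢
    simpa [norm_ftKernel] using h
  have h1 := hb atTop (fun R => -R) (hbot.comp tendsto_neg_atTop_atBot)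
  have h2 := hb atTop (fun R => R) htop
  have hik : Integrable fun x => f' x * ftKernel ξ x := by
    refine hi.norm.mono' (hf'.mul (continuous_ftKernel ξ)).aestronglyMeasurable ?_
    exact Eventually.of_forall fun x => by simp [norm_ftKernel]
  have h3 := intervalIntegral_tendsto_integral hik tendsto_neg_atTop_atBot tendsto_id
  have h4 := ((h1.sub h2).add h3).div_const (2 * π * I * ξ : ℂ)
  rw [← fourier_eq_integral_ftKernel] at h4
  simp only [sub_zero, zero_add] at h4
  refine h4.congr' ?_
  filter_upwards [eventually_ge_atTop 0] with R hR
  rw [← intervalIntegral.integral_of_le (by linarith : -R ≤ R)]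
  exact (intervalIntegral_mul_ftKernel hf hf' hξ _ _).symm

theorem tendsto_confVec {a : ℂ} (ha : 0 < a.re) {k : ℝ → ℂ} {B : ℝ} (hB : ∀ t, ‖k t‖ ≤ B) :
    Tendsto (confVec a k) atTop (nhds 0) ∧ Tendsto (confVec a k) atBot (nhds 0) := by
  have h : Tendsto (fun x : ℝ => B * (1 + x ^ 2) ^ (-a.re / 2)) atTop (nhds 0) := by
    simpa using (tendsto_one_add_sq_rpow ha).const_mul B
  refine ⟨squeeze_zero_norm (norm_confVec_le a hB) h, squeeze_zero_norm (norm_confVec_le a hB) ?_⟩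
  simpa [Function.comp_def] using h.comp tendsto_neg_atBot_atTop

theorem isImpFT_confVec {a : ℂ} (ha : 0 < a.re) {k k' : ℝ → ℂ} (hk : ∀ t, HasDerivAt k (k' t) t)
    (hk' : Continuous k') {B B' : ℝ} (hB : ∀ t, ‖k t‖ ≤ B) (hB' : ∀ t, ‖k' t‖ ≤ B')
    {ξ : ℝ} (hξ : ξ ≠ 0) :
    IsImpFT (confVec a k) ξ (impFT (confVec (a + 1) (derivProfile a k k')) ξ) := by
  have hkc : Continuous k := continuous_iff_continuousAt.2 fun x => (hk x).continuousAt
  have hd := continuous_derivProfile a hkc hk'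
  exact isImpFT_impFT (hasDerivAt_confVec a hk) (continuous_confVec _ hd)
    (integrable_confVec (by simpa using ha) hd (norm_derivProfile_le a hB hB'))
    (tendsto_confVec ha hB).1 (tendsto_confVec ha hB).2 hξ

theorem one_add_sq_rpow_le {r x : ℝ} (hr : 0 ≤ r) (hx : 0 < x) :
    (1 + x ^ 2) ^ (-r / 2) ≤ x ^ (-r) := by
  have : x ^ (-r) = (x ^ 2) ^ (-r / 2) := by
    rw [← Real.rpow_natCast_mul hx.le]
    congr 1
    push_cast
    ring
  rw [this]
  exact Real.rpow_le_rpow_of_nonpos (by positivity) (by linarith) (by linarith)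

/-- The truncated Fourier integral over `[0, R]` of a function with symbol-type decay of order
`s - 1` is dominated by `|ξ|^{-s}`, uniformly in `R`. -/
theorem norm_integral_zero_mul_ftKernel_le {s : ℝ} (hs0 : 0 < s) (hs1 : s < 1) {f f' : ℝ → ℂ}
    (hf : ∀ x, HasDerivAt f (f' x) x) (hf' : Continuous f') {B : ℝ}
    (hB : ∀ x, 0 < x → ‖f x‖ ≤ B * x ^ (s - 1)) (hB' : ∀ x, 0 < x → ‖f' x‖ ≤ B * x ^ (s - 2))
    {R : ℝ} (hR : 0 < R) {ξ : ℝ} (hξ : ξ ≠ 0) :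
    ‖∫ x in (0:ℝ)..R, f x * ftKernel ξ x‖ ≤ (B / s + B * (2 + 1 / (1 - s))) * |ξ| ^ (-s) := by
  have hfc : Continuous f := continuous_iff_continuousAt.2 fun x => (hf x).continuousAt
  have hB0 : 0 ≤ B := by simpa using (norm_nonneg _).trans (hB 1 one_pos)
  have hξ0 : 0 < |ξ| := abs_pos.2 hξ
  have hs' : 0 < 1 - s := by linarith
  set A := |ξ|⁻¹ with hA
  have hA0 : 0 < A := inv_pos.2 hξ0
  have hAs : A ^ s = |ξ| ^ (-s) := by rw [hA, Real.inv_rpow hξ0.le, Real.rpow_neg hξ0.le]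
  have key : ∀ r, 0 < r → r ≤ A →
      ‖∫ x in (0:ℝ)..r, f x * ftKernel ξ x‖ ≤ B / s * |ξ| ^ (-s) := by
    intro r hr hrA
    have h1 : ‖∫ x in (0:ℝ)..r, f x * ftKernel ξ x‖ ≤ ∫ x in (0:ℝ)..r, B * x ^ (s - 1) := by
      refine intervalIntegral.norm_integral_le_of_norm_le hr.le ?_ ?_
      · refine Eventually.of_forall fun x hx => ?_
        rw [norm_mul, norm_ftKernel, mul_one]
        exact hB x hx.1
      · exact (intervalIntegral.intervalIntegrable_rpow' (by linarith)).const_mul _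
    rw [intervalIntegral.integral_const_mul, integral_rpow (Or.inl (by linarith))] at h1
    rw [sub_add_cancel, Real.zero_rpow hs0.ne', sub_zero] at h1
    refine h1.trans ?_
    rw [← hAs, ← mul_div_assoc, div_mul_eq_mul_div]
    gcongr
  rcases le_or_gt R A with h | h
  · refine (key R hR h).trans ?_
    gcongr
    have : 0 ≤ B * (2 + 1 / (1 - s)) := by positivity
    linarith
  · have hint : ∀ a b, IntervalIntegrable (fun x => f x * ftKernel ξ x) volume a b := fun a b =>
      (hfc.mul (continuous_ftKernel ξ)).intervalIntegrable a b
    rw [← intervalIntegral.integral_add_adjacent_intervals (hint 0 A) (hint A R), add_mul]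
    refine (norm_add_le _ _).trans (add_le_add (key A hA0 le_rfl) ?_)
    refine (norm_intervalIntegral_mul_ftKernel_le hf hf' hξ h.le).trans ?_
    have h0 : (0:ℝ) ∉ Set.uIcc A R := by
      rw [Set.uIcc_of_le h.le]
      exact fun h0 => absurd h0.1 (not_le.2 hA0)
    have h1 : ‖f A‖ ≤ B * A ^ (s - 1) := hB A hA0
    have h2 : ‖f R‖ ≤ B * A ^ (s - 1) := (hB R hR).trans
      (mul_le_mul_of_nonneg_left
        (Real.rpow_le_rpow_of_nonpos hA0 h.le (by linarith)) hB0)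
    have h3 : ∫ x in A..R, ‖f' x‖ ≤ B * A ^ (s - 1) * (1 / (1 - s)) := by
      have : ∫ x in A..R, ‖f' x‖ ≤ ∫ x in A..R, B * x ^ (s - 2) := by
        refine intervalIntegral.integral_mono_on h.le (hf'.norm.intervalIntegrable _ _) ?_ ?_
        · exact (intervalIntegral.intervalIntegrable_rpow (Or.inr h0)).const_mul _
        · exact fun x hx => hB' x (hA0.trans_le hx.1)
      refine this.trans ?_
      rw [intervalIntegral.integral_const_mul, integral_rpow (Or.inr ⟨by linarith, h0⟩), mul_assoc]
      gcongr
      have e : s - 2 + 1 = -(1 - s) := by ring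
      rw [e, div_neg, ← neg_div, neg_sub, mul_one_div, neg_sub]
      gcongr
      have : 0 ≤ R ^ (s - 1) := by positivity
      linarith
    have h4 : A ^ (s - 1) = |ξ| * |ξ| ^ (-s) := by
      rw [Real.rpow_sub hA0, hAs, Real.rpow_one, hA]
      field_simp
    have hpi : 1 ≤ 2 * π := by linarith [Real.pi_gt_three]
    rw [div_le_iff₀ (by positivity)]
    calc ‖f A‖ + ‖f R‖ + ∫ x in A..R, ‖f' x‖
        ≤ B * A ^ (s - 1) * (2 + 1 / (1 - s)) := by linarith
      _ = B * (2 + 1 / (1 - s)) * |ξ| ^ (-s) * (1 * |ξ|) := by rw [h4]; ring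
      _ ≤ B * (2 + 1 / (1 - s)) * |ξ| ^ (-s) * (2 * π * |ξ|) := by gcongr

theorem norm_integral_mul_ftKernel_le {s : ℝ} (hs0 : 0 < s) (hs1 : s < 1) {f f' : ℝ → ℂ}
    (hf : ∀ x, HasDerivAt f (f' x) x) (hf' : Continuous f') {B : ℝ}
    (hB : ∀ x, x ≠ 0 → ‖f x‖ ≤ B * |x| ^ (s - 1))
    (hB' : ∀ x, x ≠ 0 → ‖f' x‖ ≤ B * |x| ^ (s - 2))
    {R : ℝ} (hR : 0 < R) {ξ : ℝ} (hξ : ξ ≠ 0) :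
    ‖∫ x in (-R)..R, f x * ftKernel ξ x‖ ≤
      2 * (B / s + B * (2 + 1 / (1 - s))) * |ξ| ^ (-s) := by
  have hfc : Continuous f := continuous_iff_continuousAt.2 fun x => (hf x).continuousAt
  have hint : ∀ a b, IntervalIntegrable (fun x => f x * ftKernel ξ x) volume a b := fun a b =>
    (hfc.mul (continuous_ftKernel ξ)).intervalIntegrable a b
  rw [← intervalIntegral.integral_add_adjacent_intervals (hint (-R) 0) (hint 0 R), mul_assoc,
    two_mul]
  refine (norm_add_le _ _).trans (add_le_add ?_ ?_)
  · have h1 : ∫ x in (-R)..0, f x * ftKernel ξ x = ∫ x in (0:ℝ)..R, f (-x) * ftKernel (-ξ) x := by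
      have := intervalIntegral.integral_comp_neg (a := 0) (b := R) fun x => f x * ftKernel ξ x
      rw [neg_zero] at this
      rw [← this]
      congr 1 with x
      simp [ftKernel]
    rw [h1, ← abs_neg ξ]
    refine norm_integral_zero_mul_ftKernel_le (f' := fun x => -f' (-x)) hs0 hs1 (fun x => ?_)
      (by fun_prop) (fun x hx => ?_) (fun x hx => ?_) hR (neg_ne_zero.2 hξ)
    · simpa [Function.comp_def] using (hf (-x)).scomp x (hasDerivAt_neg x)
    · simpa [abs_of_pos hx] using hB (-x) (by linarith)
    · simpa [abs_of_pos hx] using hB' (-x) (by linarith)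
  · refine norm_integral_zero_mul_ftKernel_le hs0 hs1 hf hf' (fun x hx => ?_) (fun x hx => ?_) hR hξ
    · simpa [abs_of_pos hx] using hB x hx.ne'
    · simpa [abs_of_pos hx] using hB' x hx.ne'

theorem exists_norm_integral_confVec_le {s : ℝ} (hs0 : 0 < s) (hs1 : s < 1) {k k' : ℝ → ℂ}
    (hk : ∀ t, HasDerivAt k (k' t) t) (hk' : Continuous k') {B B' : ℝ} (hB : ∀ t, ‖k t‖ ≤ B)
    (hB' : ∀ t, ‖k' t‖ ≤ B') :
    ∃ C, ∀ R, 0 < R → ∀ ξ, ξ ≠ 0 →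
      ‖∫ x in (-R)..R, confVec (1 - s) k x * ftKernel ξ x‖ ≤ C * |ξ| ^ (-s) := by
  have hkc : Continuous k := continuous_iff_continuousAt.2 fun x => (hk x).continuousAt
  have hd := continuous_derivProfile (1 - s) hkc hk'
  have hp : ∀ (r x : ℝ), 0 ≤ r → x ≠ 0 → (1 + x ^ 2) ^ (-r / 2) ≤ |x| ^ (-r) := fun r x hr hx => by
    simpa using one_add_sq_rpow_le hr (abs_pos.2 hx)
  have hB0 : 0 ≤ B := (norm_nonneg _).trans (hB 0)
  have hD := norm_derivProfile_le (1 - s) hB hB'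
  set D := ‖(1 - s : ℂ)‖ * B + B'
  have hD0 : 0 ≤ D := (norm_nonneg _).trans (hD 0)
  refine ⟨_, fun R hR ξ hξ => norm_integral_mul_ftKernel_le (B := B + D) hs0 hs1
    (hasDerivAt_confVec _ hk) (continuous_confVec _ hd) (fun x hx => ?_) (fun x hx => ?_) hR hξ⟩
  · have h1 := norm_confVec_le (1 - s) hB x
    have h2 := hp (1 - s) x (by linarith) hx
    rw [neg_sub] at h2
    simp only [sub_re, one_re, ofReal_re, neg_sub] at h1
    exact h1.trans (by gcongr; linarith)
  · have h1 := norm_confVec_le (1 - s + 1) hD x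
    have h2 := hp (2 - s) x (by linarith) hx
    rw [neg_sub] at h2
    have e : (1 - s + 1 : ℂ).re = 2 - s := by simp; ring
    rw [e, neg_sub] at h1
    exact h1.trans (by gcongr; linarith)

/-- The Gaussian kernel of total mass one with inverse variance proportional to `τ`. -/
def gaussKer (τ r : ℝ) : ℝ := √τ * Real.exp (-π * τ * r ^ 2)

theorem gaussKer_nonneg (τ r : ℝ) : 0 ≤ gaussKer τ r := by
  unfold gaussKer
  positivity

theorem continuous_gaussKer (τ : ℝ) : Continuous (gaussKer τ) := by
  unfold gaussKer
  fun_prop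

theorem integral_gauss_mul_ftKernel {τ : ℝ} (hτ : 0 < τ) (r : ℝ) :
    ∫ ξ : ℝ, ((Real.exp (-π / τ * ξ ^ 2) : ℝ) : ℂ) * ftKernel ξ r = (gaussKer τ r : ℂ) := by
  have hb : 0 < ((τ⁻¹ : ℝ) : ℂ).re := by simpa using hτ
  have h := congrFun (fourier_gaussian_pi hb) r
  rw [fourier_eq_integral_ftKernel] at h
  have h2 : (1 / ((τ⁻¹ : ℝ) : ℂ) ^ (1 / 2 : ℂ)) * cexp (-π / ((τ⁻¹ : ℝ) : ℂ) * r ^ 2) =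
      (gaussKer τ r : ℂ) := by
    have h3 : ((τ⁻¹ : ℝ) : ℂ) ^ (1 / 2 : ℂ) = ((√τ)⁻¹ : ℝ) := by
      rw [← Real.sqrt_inv, Real.sqrt_eq_rpow, Complex.ofReal_cpow (by positivity)]
      simp
    rw [h3, gaussKer]
    push_cast
    simp
  rw [← h2, ← h]
  congr 1 with ξ
  rw [ftKernel, ftKernel]
  push_cast
  congr 2
  ring_nf

theorem integrable_gauss {τ : ℝ} (hτ : 0 < τ) :
    Integrable fun ξ : ℝ => Real.exp (-π / τ * ξ ^ 2) := by
  simpa [neg_div] using integrable_exp_neg_mul_sq (b := π / τ) (by positivity)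

theorem lintegral_gaussKer {τ : ℝ} (hτ : 0 < τ) :
    ∫⁻ r : ℝ, ENNReal.ofReal (gaussKer τ r) = 1 := by
  have hi : Integrable (gaussKer τ) := by
    have := (integrable_exp_neg_mul_sq (b := π * τ) (by positivity)).const_mul √τ
    refine this.congr (Eventually.of_forall fun r => ?_)
    simp [gaussKer]
  rw [← ofReal_integral_eq_lintegral_ofReal hi (Eventually.of_forall (gaussKer_nonneg τ))]
  have : ∫ r, gaussKer τ r = 1 := by
    have h := integral_gaussian (π * τ)
    simp only [gaussKer, integral_const_mul]
    rw [show (fun r : ℝ => Real.exp (-π * τ * r ^ 2)) =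
      fun r : ℝ => Real.exp (-(π * τ) * r ^ 2) by ext; ring_nf, h, ← Real.sqrt_mul hτ.le,
      show τ * (π / (π * τ)) = 1 by field_simp, Real.sqrt_one]
  simp [this]

theorem fourier_mul_conj_fourier {f : ℝ → ℂ} (ξ : ℝ) :
    𝓕 f ξ * conj (𝓕 f ξ) =
      ∫ z : ℝ × ℝ, f z.1 * conj (f z.2) * ftKernel ξ (z.1 - z.2) := by
  rw [fourier_eq_integral_ftKernel, ← integral_conj, Measure.volume_eq_prod,
    ← integral_prod_mul]
  congr 1 with z
  have : ftKernel ξ (z.1 - z.2) = ftKernel ξ z.1 * conj (ftKernel ξ z.2) := by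
    simp only [ftKernel, ← Complex.exp_conj, ← Complex.exp_add]
    congr 1
    simp only [map_mul, map_neg, Complex.conj_ofReal, Complex.conj_I, map_ofNat]
    push_cast
    ring
  rw [this, map_mul]
  ring

theorem integrable_mul_conj_prod {f : ℝ → ℂ} (hf : Integrable f) :
    Integrable fun z : ℝ × ℝ => f z.1 * conj (f z.2) := by
  have h2 : Integrable fun x => conj (f x) :=
    (Complex.conjLIE.toContinuousLinearEquiv.integrable_comp_iff).2 hf
  exact hf.mul_prod h2

theorem integral_gauss_mul_fourier {f : ℝ → ℂ} (hf : Integrable f) {τ : ℝ} (hτ : 0 < τ) :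
    ∫ ξ : ℝ, ((Real.exp (-π / τ * ξ ^ 2) : ℝ) : ℂ) * (𝓕 f ξ * conj (𝓕 f ξ)) =
      ∫ z : ℝ × ℝ, f z.1 * conj (f z.2) * (gaussKer τ (z.1 - z.2) : ℂ) := by
  have hprod := integrable_mul_conj_prod hf
  have hg : Integrable fun ξ : ℝ => ((Real.exp (-π / τ * ξ ^ 2) : ℝ) : ℂ) :=
    (integrable_gauss hτ).ofReal
  have hi : Integrable (fun w : ℝ × (ℝ × ℝ) => ((Real.exp (-π / τ * w.1 ^ 2) : ℝ) : ℂ) *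
      (f w.2.1 * conj (f w.2.2)) * ftKernel w.1 (w.2.1 - w.2.2)) := by
    have h1 := hg.mul_prod hprod
    refine h1.mul_bdd (c := 1) ?_ (Eventually.of_forall fun w => (norm_ftKernel _ _).le)
    refine Continuous.aestronglyMeasurable ?_
    unfold ftKernel
    fun_prop
  calc ∫ ξ : ℝ, ((Real.exp (-π / τ * ξ ^ 2) : ℝ) : ℂ) * (𝓕 f ξ * conj (𝓕 f ξ))
      = ∫ ξ : ℝ, ∫ z : ℝ × ℝ, ((Real.exp (-π / τ * ξ ^ 2) : ℝ) : ℂ) *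
          (f z.1 * conj (f z.2)) * ftKernel ξ (z.1 - z.2) := by
        congr 1 with ξ
        rw [fourier_mul_conj_fourier, ← integral_const_mul]
        congr 1 with z
        ring
    _ = ∫ z : ℝ × ℝ, ∫ ξ : ℝ, ((Real.exp (-π / τ * ξ ^ 2) : ℝ) : ℂ) *
          (f z.1 * conj (f z.2)) * ftKernel ξ (z.1 - z.2) := integral_integral_swap hi
    _ = _ := by
        congr 1 with z
        rw [← integral_gauss_mul_ftKernel hτ, ← integral_const_mul]
        congr 1 with ξ
        ring

theorem lintegral_gauss_mul_fourier {f : ℝ → ℂ} (hf : Integrable f) {τ : ℝ} (hτ : 0 < τ) :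
    ∫⁻ ξ : ℝ, ENNReal.ofReal (Real.exp (-π / τ * ξ ^ 2) * ‖𝓕 f ξ‖ ^ 2) =
      ENNReal.ofReal (∫ z : ℝ × ℝ, f z.1 * conj (f z.2) * (gaussKer τ (z.1 - z.2) : ℂ)).re := by
  have hi : Integrable fun ξ : ℝ => Real.exp (-π / τ * ξ ^ 2) * ‖𝓕 f ξ‖ ^ 2 := by
    refine (integrable_gauss hτ).mul_bdd (c := (∫ x, ‖f x‖) ^ 2) ?_ ?_
    · exact ((continuous_fourier hf).norm.pow 2).aestronglyMeasurable
    · refine Eventually.of_forall fun ξ => ?_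
      rw [norm_pow, norm_norm]
      gcongr
      exact norm_fourier_le f ξ
  rw [← ofReal_integral_eq_lintegral_ofReal hi (Eventually.of_forall fun ξ => by positivity),
    ← integral_gauss_mul_fourier hf hτ]
  congr 1
  rw [← Complex.ofReal_re (∫ ξ : ℝ, Real.exp (-π / τ * ξ ^ 2) * ‖𝓕 f ξ‖ ^ 2),
    ← integral_complex_ofReal]
  congr 2 with ξ
  rw [Complex.mul_conj, Complex.normSq_eq_norm_sq]
  push_cast
  ring

/-- Bessel's inequality for the Fourier transform on `L¹ ∩ L²`. -/
theorem lintegral_fourier_sq_le {f : ℝ → ℂ} (hf : Integrable f) :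
    ∫⁻ ξ : ℝ, ENNReal.ofReal (‖𝓕 f ξ‖ ^ 2) ≤ ∫⁻ x, ENNReal.ofReal (‖f x‖ ^ 2) := by
  have hfm : AEMeasurable (fun x => ENNReal.ofReal (‖f x‖ ^ 2)) :=
    (hf.1.norm.aemeasurable.pow_const 2).ennreal_ofReal
  have hFm := (continuous_fourier hf).measurable
  have hbound : ∀ τ : ℝ, 0 < τ →
      ∫⁻ ξ : ℝ, ENNReal.ofReal (Real.exp (-π / τ * ξ ^ 2) * ‖𝓕 f ξ‖ ^ 2) ≤
        ∫⁻ x, ENNReal.ofReal (‖f x‖ ^ 2) := by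
    intro τ hτ
    rw [lintegral_gauss_mul_fourier hf hτ]
    have hkm : Measurable fun x => ENNReal.ofReal (gaussKer τ x) :=
      (continuous_gaussKer τ).measurable.ennreal_ofReal
    set A := fun z : ℝ × ℝ => ENNReal.ofReal (‖f z.1‖ ^ 2) * ENNReal.ofReal (gaussKer τ (z.1 - z.2))
      with hA
    set B := fun z : ℝ × ℝ => ENNReal.ofReal (‖f z.2‖ ^ 2) * ENNReal.ofReal (gaussKer τ (z.1 - z.2))
      with hB
    have hAm : AEMeasurable A (volume.prod volume) :=
      (hfm.comp_quasiMeasurePreserving Measure.quasiMeasurePreserving_fst).mul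
        (hkm.comp (measurable_fst.sub measurable_snd)).aemeasurable
    have hBm : AEMeasurable B (volume.prod volume) :=
      (hfm.comp_quasiMeasurePreserving Measure.quasiMeasurePreserving_snd).mul
        (hkm.comp (measurable_fst.sub measurable_snd)).aemeasurable
    have hAi : ∫⁻ z, A z = ∫⁻ x, ENNReal.ofReal (‖f x‖ ^ 2) := by
      rw [Measure.volume_eq_prod, lintegral_prod _ hAm]
      congr 1 with x
      simp only [hA]
      rw [lintegral_const_mul' _ _ ENNReal.ofReal_ne_top,
        lintegral_sub_left_eq_self (fun y => ENNReal.ofReal (gaussKer τ y)) x,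
        lintegral_gaussKer hτ, mul_one]
    have hBi : ∫⁻ z, B z = ∫⁻ x, ENNReal.ofReal (‖f x‖ ^ 2) := by
      rw [Measure.volume_eq_prod, lintegral_prod_symm _ hBm]
      congr 1 with x
      simp only [hB]
      rw [lintegral_const_mul' _ _ ENNReal.ofReal_ne_top,
        lintegral_sub_right_eq_self (fun y => ENNReal.ofReal (gaussKer τ y)) x,
        lintegral_gaussKer hτ, mul_one]
    calc _ ≤ ENNReal.ofReal
            ‖∫ z : ℝ × ℝ, f z.1 * conj (f z.2) * (gaussKer τ (z.1 - z.2) : ℂ)‖ :=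
          ENNReal.ofReal_le_ofReal (Complex.re_le_norm _)
      _ ≤ ∫⁻ z : ℝ × ℝ, ‖f z.1 * conj (f z.2) * (gaussKer τ (z.1 - z.2) : ℂ)‖ₑ := by
          rw [ofReal_norm]
          exact enorm_integral_le_lintegral_enorm _
      _ ≤ ∫⁻ z : ℝ × ℝ, ENNReal.ofReal (1 / 2) * (A z + B z) := by
          refine lintegral_mono fun z => ?_
          rw [← ofReal_norm, hA, hB]
          simp only
          rw [← add_mul, ← ENNReal.ofReal_add (by positivity) (by positivity),
            ← ENNReal.ofReal_mul (by positivity), ← ENNReal.ofReal_mul (by positivity)]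
          refine ENNReal.ofReal_le_ofReal ?_
          rw [norm_mul, norm_mul, Complex.norm_real, RCLike.norm_conj, Real.norm_eq_abs,
            abs_of_nonneg (gaussKer_nonneg _ _), ← mul_assoc]
          refine mul_le_mul_of_nonneg_right ?_ (gaussKer_nonneg _ _)
          nlinarith [sq_nonneg (‖f z.1‖ - ‖f z.2‖)]
      _ = _ := by
          rw [lintegral_const_mul' _ _ ENNReal.ofReal_ne_top,
            lintegral_add_left' (by simpa [Measure.volume_eq_prod] using hAm), hAi, hBi, ← two_mul,
            ← mul_assoc]
          have : ENNReal.ofReal (1 / 2) * 2 = 1 := by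
            rw [show (2 : ℝ≥0∞) = ENNReal.ofReal 2 by simp, ← ENNReal.ofReal_mul (by norm_num)]
            norm_num
          rw [this, one_mul]
  have hlim : ∀ ξ : ℝ, Tendsto
      (fun n : ℕ => ENNReal.ofReal (Real.exp (-π / ((n : ℝ) + 1) * ξ ^ 2) * ‖𝓕 f ξ‖ ^ 2)) atTop
      (nhds (ENNReal.ofReal (‖𝓕 f ξ‖ ^ 2))) := by
    intro ξ
    refine ENNReal.tendsto_ofReal ?_
    have h1 : Tendsto (fun n : ℕ => -π / ((n : ℝ) + 1)) atTop (nhds 0) :=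
      tendsto_const_nhds.div_atTop
        (tendsto_atTop_add_const_right _ _ tendsto_natCast_atTop_atTop)
    have h2 := ((Real.continuous_exp.tendsto _).comp (h1.mul_const (ξ ^ 2))).mul_const
      (‖𝓕 f ξ‖ ^ 2)
    simpa using h2
  calc ∫⁻ ξ : ℝ, ENNReal.ofReal (‖𝓕 f ξ‖ ^ 2)
      = ∫⁻ ξ : ℝ, liminf (fun n : ℕ =>
          ENNReal.ofReal (Real.exp (-π / ((n : ℝ) + 1) * ξ ^ 2) * ‖𝓕 f ξ‖ ^ 2)) atTop := by
        congr 1 with ξ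
        exact (hlim ξ).liminf_eq.symm
    _ ≤ liminf (fun n : ℕ => ∫⁻ ξ : ℝ,
          ENNReal.ofReal (Real.exp (-π / ((n : ℝ) + 1) * ξ ^ 2) * ‖𝓕 f ξ‖ ^ 2)) atTop :=
        lintegral_liminf_le fun n => by fun_prop
    _ ≤ _ := by
        refine liminf_le_of_le (by isBoundedDefault) fun b hb => ?_
        obtain ⟨n, hn⟩ := hb.exists
        exact hn.trans (hbound _ (by positivity))

theorem ae_fst_ne_snd : ∀ᵐ z : ℝ × ℝ, z.1 ≠ z.2 := by
  have hm : MeasurableSet {z : ℝ × ℝ | z.1 = z.2} := measurableSet_eq_fun measurable_fst measurable_snd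
  rw [ae_iff, Measure.volume_eq_prod]
  simp only [ne_eq, not_not]
  rw [Measure.measure_prod_null hm]
  refine Eventually.of_forall fun x => ?_
  have : Prod.mk x ⁻¹' {z : ℝ × ℝ | z.1 = z.2} = {x} := by
    ext y
    simp [eq_comm]
  simp [this]

theorem rpow_mul_gaussKer {s τ : ℝ} (hτ : 0 < τ) (r : ℝ) :
    τ ^ (-s / 2 - 1) * gaussKer τ r = τ ^ ((1 - s) / 2 - 1) * Real.exp (-((π * r ^ 2) * τ)) := by
  rw [gaussKer, Real.sqrt_eq_rpow, ← mul_assoc, ← Real.rpow_add hτ]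
  ring_nf

theorem integral_rpow_mul_gaussKer {s r : ℝ} (hs1 : s < 1) (hr : r ≠ 0) :
    ∫ τ in Ioi (0 : ℝ), τ ^ (-s / 2 - 1) * gaussKer τ r =
      π ^ ((s - 1) / 2) * Real.Gamma ((1 - s) / 2) * |r| ^ (s - 1) := by
  rw [setIntegral_congr_fun measurableSet_Ioi fun τ hτ => rpow_mul_gaussKer hτ r,
    Real.integral_rpow_mul_exp_neg_mul_Ioi (by linarith) (by positivity), ← sq_abs r, one_div,
    Real.inv_rpow (by positivity), Real.mul_rpow (by positivity) (by positivity),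
    ← Real.rpow_natCast, ← Real.rpow_mul (abs_nonneg r), mul_inv, ← Real.rpow_neg (by positivity),
    ← Real.rpow_neg (by positivity)]
  push_cast
  ring_nf

theorem integrableOn_rpow_mul_gaussKer {s r : ℝ} (hs1 : s < 1) (hr : r ≠ 0) :
    IntegrableOn (fun τ => τ ^ (-s / 2 - 1) * gaussKer τ r) (Ioi (0 : ℝ)) := by
  by_contra h
  have h1 := integral_undef h
  rw [integral_rpow_mul_gaussKer hs1 hr] at h1
  have h2 := Real.Gamma_pos_of_pos (show 0 < (1 - s) / 2 by linarith)
  have : 0 < π ^ ((s - 1) / 2) * Real.Gamma ((1 - s) / 2) * |r| ^ (s - 1) := by positivity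
  exact this.ne' h1

theorem le_lintegral_rpow_mul_gauss {s ξ : ℝ} (hs0 : 0 < s) (hξ : ξ ≠ 0) :
    ENNReal.ofReal (2 ^ (-s / 2 - 1) * Real.exp (-π) * |ξ| ^ (-s)) ≤
      ∫⁻ τ in Ioi (0 : ℝ), ENNReal.ofReal (τ ^ (-s / 2 - 1) * Real.exp (-π / τ * ξ ^ 2)) := by
  have hx : 0 < ξ ^ 2 := by positivity
  have hpow : (2 * ξ ^ 2) ^ (-s / 2 - 1) * ξ ^ 2 = 2 ^ (-s / 2 - 1) * |ξ| ^ (-s) := by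
    rw [Real.mul_rpow (by norm_num) hx.le, mul_assoc, ← sq_abs ξ, ← Real.rpow_natCast |ξ| 2,
      ← Real.rpow_mul (abs_nonneg ξ), ← Real.rpow_add (abs_pos.2 hξ)]
    push_cast
    ring_nf
  calc ENNReal.ofReal (2 ^ (-s / 2 - 1) * Real.exp (-π) * |ξ| ^ (-s))
      = ∫⁻ _τ in Ioo (ξ ^ 2) (2 * ξ ^ 2),
          ENNReal.ofReal ((2 * ξ ^ 2) ^ (-s / 2 - 1) * Real.exp (-π)) := by
        rw [setLIntegral_const, Real.volume_Ioo, ← ENNReal.ofReal_mul (by positivity)]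
        congr 1
        rw [show 2 * ξ ^ 2 - ξ ^ 2 = ξ ^ 2 by ring, mul_right_comm, ← hpow]
        ring
    _ ≤ ∫⁻ τ in Ioo (ξ ^ 2) (2 * ξ ^ 2),
          ENNReal.ofReal (τ ^ (-s / 2 - 1) * Real.exp (-π / τ * ξ ^ 2)) := by
        refine setLIntegral_mono' measurableSet_Ioo fun τ hτ => ENNReal.ofReal_le_ofReal ?_
        have hτ0 : 0 < τ := hx.trans hτ.1
        refine mul_le_mul ?_ ?_ (by positivity) (by positivity)
        · exact Real.rpow_le_rpow_of_nonpos hτ0 hτ.2.le (by linarith)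
        · refine Real.exp_le_exp.2 ?_
          rw [neg_div, neg_mul, neg_le_neg_iff, div_mul_eq_mul_div, div_le_iff₀ hτ0]
          exact mul_le_mul_of_nonneg_left hτ.1.le pi_pos.le
    _ ≤ _ := lintegral_mono_set fun τ hτ => hx.trans hτ.1

/-- The constant of the Riesz kernel estimate. -/
def rieszConst (s : ℝ) : ℝ :=
  (2 ^ (-s / 2 - 1) * Real.exp (-π))⁻¹ * (π ^ ((s - 1) / 2) * Real.Gamma ((1 - s) / 2))

theorem rieszConst_pos {s : ℝ} (hs1 : s < 1) : 0 < rieszConst s := by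
  have := Real.Gamma_pos_of_pos (show 0 < (1 - s) / 2 by linarith)
  unfold rieszConst
  positivity

theorem lintegral_rpow_mul_fourier_sq_le {s : ℝ} (hs0 : 0 < s) (hs1 : s < 1) {f : ℝ → ℂ}
    (hfc : Continuous f) (hf : Integrable f)
    (hK : Integrable fun z : ℝ × ℝ =>
      f z.1 * conj (f z.2) * ((|z.1 - z.2| ^ (s - 1) : ℝ) : ℂ)) :
    ∫⁻ ξ : ℝ, ENNReal.ofReal (|ξ| ^ (-s) * ‖𝓕 f ξ‖ ^ 2) ≤
      ENNReal.ofReal (rieszConst s * ‖∫ z : ℝ × ℝ,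
        f z.1 * conj (f z.2) * ((|z.1 - z.2| ^ (s - 1) : ℝ) : ℂ)‖) := by
  have hΓ := Real.Gamma_pos_of_pos (show 0 < (1 - s) / 2 by linarith)
  set c₁ : ℝ := 2 ^ (-s / 2 - 1) * Real.exp (-π) with hc₁
  set c₂ : ℝ := π ^ ((s - 1) / 2) * Real.Gamma ((1 - s) / 2) with hc₂
  have hc₁0 : 0 < c₁ := by positivity
  have hc₂0 : 0 < c₂ := by positivity
  have hFc := continuous_fourier hf
  set Ψ : ℝ × (ℝ × ℝ) → ℂ := fun w => ((w.1 ^ (-s / 2 - 1) * gaussKer w.1 (w.2.1 - w.2.2) : ℝ) : ℂ) *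
    (f w.2.1 * conj (f w.2.2)) with hΨ
  have hgm : Measurable fun w : ℝ × (ℝ × ℝ) => gaussKer w.1 (w.2.1 - w.2.2) := by
    unfold gaussKer
    fun_prop
  have hΨm : Measurable Ψ := by
    have h1 : Measurable fun w : ℝ × (ℝ × ℝ) => w.1 ^ (-s / 2 - 1) := by fun_prop
    refine (Complex.measurable_ofReal.comp (h1.mul hgm)).mul ?_
    exact Continuous.measurable (by fun_prop)
  have hΨi : Integrable Ψ ((volume.restrict (Ioi 0)).prod volume) := by
    rw [integrable_prod_iff' hΨm.aestronglyMeasurable]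
    constructor
    · filter_upwards [ae_fst_ne_snd] with z hz
      have := integrableOn_rpow_mul_gaussKer hs1 (sub_ne_zero.2 hz)
      exact (Integrable.ofReal (𝕜 := ℂ) this).mul_const (f z.1 * conj (f z.2))
    · refine (hK.norm.const_mul c₂).congr ?_
      filter_upwards [ae_fst_ne_snd] with z hz
      have : ∀ τ ∈ Ioi (0 : ℝ), ‖Ψ (τ, z)‖ =
          τ ^ (-s / 2 - 1) * gaussKer τ (z.1 - z.2) * ‖f z.1 * conj (f z.2)‖ := by
        intro τ hτ
        rw [hΨ]
        simp only
        rw [norm_mul, Complex.norm_real, Real.norm_eq_abs, abs_of_nonneg]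
        exact mul_nonneg (Real.rpow_nonneg (le_of_lt hτ) _) (gaussKer_nonneg _ _)
      rw [setIntegral_congr_fun measurableSet_Ioi this, integral_mul_const,
        integral_rpow_mul_gaussKer hs1 (sub_ne_zero.2 hz), norm_mul (f z.1 * conj (f z.2)),
        Complex.norm_real, Real.norm_eq_abs, abs_of_nonneg (by positivity), hc₂]
      ring
  set φ : ℝ → ℝ := fun τ => (∫ z, Ψ (τ, z)).re with hφ
  have hφi : IntegrableOn φ (Ioi 0) := hΨi.integral_prod_left.re
  have hφeq : ∀ τ ∈ Ioi (0 : ℝ), ENNReal.ofReal (φ τ) =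
      ∫⁻ ξ : ℝ, ENNReal.ofReal (τ ^ (-s / 2 - 1) * (Real.exp (-π / τ * ξ ^ 2) * ‖𝓕 f ξ‖ ^ 2)) ∧
      0 ≤ φ τ := by
    intro τ hτ
    have hτ' : 0 ≤ τ ^ (-s / 2 - 1) := Real.rpow_nonneg (le_of_lt hτ) _
    have h1 : φ τ = τ ^ (-s / 2 - 1) *
        (∫ z : ℝ × ℝ, f z.1 * conj (f z.2) * (gaussKer τ (z.1 - z.2) : ℂ)).re := by
      rw [hφ]
      simp only
      rw [← Complex.re_ofReal_mul, ← integral_const_mul]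
      congr 2 with z
      rw [hΨ]
      push_cast
      ring
    constructor
    · rw [h1, ENNReal.ofReal_mul hτ', ← lintegral_gauss_mul_fourier hf hτ,
        ← lintegral_const_mul' _ _ ENNReal.ofReal_ne_top]
      congr 1 with ξ
      rw [← ENNReal.ofReal_mul hτ']
    · rw [h1, ← integral_gauss_mul_fourier hf hτ]
      refine mul_nonneg hτ' ?_
      have : ∀ ξ : ℝ, ((Real.exp (-π / τ * ξ ^ 2) : ℝ) : ℂ) * (𝓕 f ξ * conj (𝓕 f ξ)) =
          ((Real.exp (-π / τ * ξ ^ 2) * ‖𝓕 f ξ‖ ^ 2 : ℝ) : ℂ) := by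
        intro ξ
        rw [Complex.mul_conj, Complex.normSq_eq_norm_sq]
        push_cast
        ring
      simp_rw [this]
      rw [integral_complex_ofReal, Complex.ofReal_re]
      exact integral_nonneg fun ξ => by positivity
  have hmain : ∫⁻ τ in Ioi (0 : ℝ), ENNReal.ofReal (φ τ) ≤
      ENNReal.ofReal (c₂ * ‖∫ z : ℝ × ℝ,
        f z.1 * conj (f z.2) * ((|z.1 - z.2| ^ (s - 1) : ℝ) : ℂ)‖) := by
    rw [← ofReal_integral_eq_lintegral_ofReal hφi
      ((ae_restrict_iff' measurableSet_Ioi).2 (Eventually.of_forall fun τ hτ => (hφeq τ hτ).2))]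
    refine ENNReal.ofReal_le_ofReal ?_
    have h1 : ∫ τ in Ioi (0 : ℝ), φ τ = (∫ τ in Ioi (0 : ℝ), ∫ z, Ψ (τ, z)).re :=
      integral_re hΨi.integral_prod_left
    have h2 : ∫ τ in Ioi (0 : ℝ), ∫ z, Ψ (τ, z) = c₂ * ∫ z : ℝ × ℝ,
        f z.1 * conj (f z.2) * ((|z.1 - z.2| ^ (s - 1) : ℝ) : ℂ) := by
      rw [integral_integral_swap hΨi, ← integral_const_mul]
      refine integral_congr_ae ?_
      filter_upwards [ae_fst_ne_snd] with z hz
      rw [hΨ]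
      simp only
      rw [integral_mul_const, integral_complex_ofReal,
        integral_rpow_mul_gaussKer hs1 (sub_ne_zero.2 hz), ← hc₂]
      push_cast
      ring
    rw [h1, h2]
    refine (Complex.re_le_norm _).trans ?_
    rw [norm_mul, Complex.norm_real, Real.norm_eq_abs, abs_of_pos hc₂0]
  have hlow : ENNReal.ofReal c₁ * ∫⁻ ξ : ℝ, ENNReal.ofReal (|ξ| ^ (-s) * ‖𝓕 f ξ‖ ^ 2) ≤
      ∫⁻ τ in Ioi (0 : ℝ), ENNReal.ofReal (φ τ) := by
    rw [setLIntegral_congr_fun measurableSet_Ioi fun τ hτ => (hφeq τ hτ).1]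
    rw [lintegral_lintegral_swap (by
      refine Measurable.aemeasurable ?_
      have : Measurable (𝓕 f) := hFc.measurable
      fun_prop), ← lintegral_const_mul' _ _ ENNReal.ofReal_ne_top]
    refine lintegral_mono_ae ?_
    filter_upwards [compl_mem_ae_iff.2 (measure_singleton (0 : ℝ))] with ξ hξ
    have h1 := le_lintegral_rpow_mul_gauss hs0 (show ξ ≠ 0 from hξ)
    rw [← ENNReal.ofReal_mul hc₁0.le, ← mul_assoc, ENNReal.ofReal_mul (by positivity)]
    refine (mul_le_mul_left h1 _).trans ?_
    rw [← lintegral_mul_const' _ _ ENNReal.ofReal_ne_top]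
    refine lintegral_mono fun τ => ?_
    rw [← ENNReal.ofReal_mul' (by positivity), mul_assoc]
  have hfin := hlow.trans hmain
  rw [rieszConst, ← hc₁, ← hc₂, mul_assoc, ENNReal.ofReal_mul (by positivity),
    ENNReal.ofReal_inv_of_pos hc₁0]
  rw [mul_comm] at hfin
  rw [mul_comm, ← div_eq_mul_inv, ENNReal.le_div_iff_mul_le (by simp [hc₁0]) (by simp)]
  exact hfin

section ChangeOfVariables

variable {E : Type*} [NormedAddCommGroup E] [NormedSpace ℝ E]

theorem integral_eq_integral_tan (F : ℝ → E) :
    ∫ x, F x = ∫ t in Ioo (-(π / 2)) (π / 2), |1 / Real.cos t ^ 2| • F (Real.tan t) := by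
  rw [← integral_image_eq_integral_abs_deriv_smul measurableSet_Ioo
    (fun t ht => (hasDerivAt_tan_of_mem_Ioo ht).hasDerivWithinAt) Real.injOn_tan,
    Real.image_tan_Ioo, Measure.restrict_univ]

theorem integrable_iff_integrableOn_tan (F : ℝ → E) :
    Integrable F ↔ IntegrableOn (fun t => |1 / Real.cos t ^ 2| • F (Real.tan t))
      (Ioo (-(π / 2)) (π / 2)) := by
  rw [← integrableOn_image_iff_integrableOn_abs_deriv_smul measurableSet_Ioo
    (fun t ht => (hasDerivAt_tan_of_mem_Ioo ht).hasDerivWithinAt) Real.injOn_tan,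
    Real.image_tan_Ioo, integrableOn_univ]

end ChangeOfVariables

theorem one_add_tan_sq_rpow {t : ℝ} (ht : t ∈ Ioo (-(π / 2)) (π / 2)) (σ : ℝ) :
    (1 + Real.tan t ^ 2) ^ (-σ / 2) = Real.cos t ^ σ := by
  have hc := Real.cos_pos_of_mem_Ioo ht
  have h := Real.inv_one_add_tan_sq hc.ne'
  rw [neg_div, Real.rpow_neg (by positivity), ← Real.inv_rpow (by positivity), h,
    ← Real.rpow_natCast, ← Real.rpow_mul hc.le]
  push_cast
  ring_nf

theorem confVec_ofReal (σ : ℝ) (k : ℝ → ℂ) (x : ℝ) :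
    confVec (σ : ℂ) k x = (((1 + x ^ 2) ^ (-σ / 2) : ℝ) : ℂ) * k (Real.arctan x) := by
  rw [confVec, Complex.ofReal_cpow (by positivity)]
  push_cast
  rfl

theorem confVec_tan (σ : ℝ) (k : ℝ → ℂ) {t : ℝ} (ht : t ∈ Ioo (-(π / 2)) (π / 2)) :
    confVec (σ : ℂ) k (Real.tan t) = ((Real.cos t ^ σ : ℝ) : ℂ) * k t := by
  rw [confVec_ofReal, one_add_tan_sq_rpow ht, Real.arctan_tan ht.1 ht.2]

theorem abs_tan_sub_tan_rpow {t t' : ℝ} (ht : t ∈ Ioo (-(π / 2)) (π / 2))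
    (ht' : t' ∈ Ioo (-(π / 2)) (π / 2)) (s : ℝ) :
    |Real.tan t - Real.tan t'| ^ (s - 1) =
      |Real.sin (t - t')| ^ (s - 1) * Real.cos t ^ (1 - s) * Real.cos t' ^ (1 - s) := by
  have hc := Real.cos_pos_of_mem_Ioo ht
  have hc' := Real.cos_pos_of_mem_Ioo ht'
  have : Real.tan t - Real.tan t' = Real.sin (t - t') / (Real.cos t * Real.cos t') := by
    rw [Real.tan_eq_sin_div_cos, Real.tan_eq_sin_div_cos, Real.sin_sub]
    field_simp
  rw [this, abs_div, abs_of_pos (mul_pos hc hc'), Real.div_rpow (abs_nonneg _) (by positivity),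
    Real.mul_rpow hc.le hc'.le, div_eq_mul_inv, mul_inv, ← Real.rpow_neg hc.le,
    ← Real.rpow_neg hc'.le, neg_sub, mul_assoc]

theorem integral_confVec_mul_conj_confVec (s : ℝ) (k₁ k₂ : ℝ → ℂ) :
    ∫ x, confVec ((1 - s : ℝ) : ℂ) k₁ x * conj (confVec ((1 + s : ℝ) : ℂ) k₂ x) =
      ∫ t in -(π / 2)..π / 2, k₁ t * conj (k₂ t) := by
  rw [intervalIntegral.integral_of_le (by linarith [pi_pos]), integral_Ioc_eq_integral_Ioo,
    integral_eq_integral_tan]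
  refine setIntegral_congr_fun measurableSet_Ioo fun t ht => ?_
  have hc := Real.cos_pos_of_mem_Ioo ht
  have h1 : Real.cos t ^ (1 - s) * Real.cos t ^ (1 + s) = Real.cos t ^ 2 := by
    rw [← Real.rpow_add hc, ← Real.rpow_natCast]
    norm_num
  rw [confVec_tan _ _ ht, confVec_tan _ _ ht, Complex.real_smul, map_mul, Complex.conj_ofReal]
  calc _ = ((|1 / Real.cos t ^ 2| * (Real.cos t ^ (1 - s) * Real.cos t ^ (1 + s)) : ℝ) : ℂ) *
        (k₁ t * conj (k₂ t)) := by
        push_cast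
        ring
    _ = _ := by
        rw [h1, abs_of_pos (by positivity), one_div, inv_mul_cancel₀ (by positivity)]
        simp

/-- The `π`-periodic Riesz kernel on the circle. -/
def sinKer (s t : ℝ) : ℝ := |Real.sin t| ^ (s - 1)

theorem sinKer_periodic (s : ℝ) : Function.Periodic (sinKer s) π := fun t => by
  simp [sinKer]

theorem intervalIntegrable_sinKer {s : ℝ} (hs0 : 0 < s) (a b : ℝ) :
    IntervalIntegrable (sinKer s) volume a b := by
  refine (sinKer_periodic s).intervalIntegrable₀ pi_pos.ne' ?_ a b
  have h1 := integrable_one_add_sq_rpow (r := 1 + s) (by linarith)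
  rw [integrable_iff_integrableOn_tan] at h1
  have h2 : IntegrableOn (fun t => Real.cos t ^ (s - 1)) (Ioo (-(π / 2)) (π / 2)) := by
    refine h1.congr_fun (fun t ht => ?_) measurableSet_Ioo
    have hc := Real.cos_pos_of_mem_Ioo ht
    simp only
    rw [one_add_tan_sq_rpow ht, abs_of_pos (by positivity), smul_eq_mul, one_div,
      ← Real.rpow_natCast, ← Real.rpow_neg hc.le, ← Real.rpow_add hc]
    push_cast
    ring_nf
  rw [← intervalIntegrable_iff_integrableOn_Ioo_of_le (by linarith [pi_pos])] at h2
  have h3 := h2.comp_sub_right (π / 2)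
  rw [show -(π / 2) + π / 2 = 0 by ring, show π / 2 + π / 2 = π by ring] at h3
  refine h3.congr (fun t ht => ?_)
  rw [uIoc_of_le pi_pos.le] at ht
  rw [sinKer, Real.cos_sub_pi_div_two, abs_of_nonneg (Real.sin_nonneg_of_mem_Icc ⟨ht.1.le, ht.2⟩)]

theorem intervalIntegrable_mul_sinKer {s : ℝ} (hs0 : 0 < s) {k : ℝ → ℂ} (hk : Continuous k)
    (c a b : ℝ) : IntervalIntegrable (fun t => k t * ((sinKer s (t - c) : ℝ) : ℂ)) volume a b := by
  have h1 := (intervalIntegrable_sinKer hs0 (a - c) (b - c)).comp_sub_right c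
  rw [sub_add_cancel, sub_add_cancel] at h1
  have h2 : IntervalIntegrable (fun t => ((sinKer s (t - c) : ℝ) : ℂ)) volume a b :=
    ⟨Integrable.ofReal (𝕜 := ℂ) h1.1, Integrable.ofReal (𝕜 := ℂ) h1.2⟩
  exact h2.continuousOn_mul hk.continuousOn

theorem abs_smul_confVec_mul_tan_sub_tan {s t t' : ℝ} (ht : t ∈ Ioo (-(π / 2)) (π / 2))
    (ht' : t' ∈ Ioo (-(π / 2)) (π / 2)) (k : ℝ → ℂ) :
    |1 / Real.cos t ^ 2| • (confVec ((1 + s : ℝ) : ℂ) k (Real.tan t) *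
        ((|Real.tan t - Real.tan t'| ^ (s - 1) : ℝ) : ℂ)) =
      ((Real.cos t' ^ (1 - s) : ℝ) : ℂ) * (k t * ((sinKer s (t - t') : ℝ) : ℂ)) := by
  have hc := Real.cos_pos_of_mem_Ioo ht
  have h1 : Real.cos t ^ (1 + s) * Real.cos t ^ (1 - s) = Real.cos t ^ 2 := by
    rw [← Real.rpow_add hc, ← Real.rpow_natCast]
    norm_num
  rw [confVec_tan _ _ ht, abs_tan_sub_tan_rpow ht ht', Complex.real_smul, sinKer]
  calc _ = ((|1 / Real.cos t ^ 2| * (Real.cos t ^ (1 + s) * Real.cos t ^ (1 - s)) : ℝ) : ℂ) *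
        (((Real.cos t' ^ (1 - s) : ℝ) : ℂ) * (k t * ((|Real.sin (t - t')| ^ (s - 1) : ℝ) : ℂ))) := by
        push_cast
        ring
    _ = _ := by
        rw [h1, abs_of_pos (by positivity), one_div, inv_mul_cancel₀ (by positivity)]
        simp

theorem integrable_confVec_mul_rpow_sub {s : ℝ} (hs0 : 0 < s) {k : ℝ → ℂ} (hk : Continuous k)
    (y : ℝ) : Integrable fun x =>
      confVec ((1 + s : ℝ) : ℂ) k x * ((|x - y| ^ (s - 1) : ℝ) : ℂ) := by
  have hy := Real.arctan_mem_Ioo y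
  rw [← Real.tan_arctan y, integrable_iff_integrableOn_tan]
  have h := (intervalIntegrable_mul_sinKer hs0 hk (Real.arctan y) (-(π / 2)) (π / 2)).const_mul
    ((Real.cos (Real.arctan y) ^ (1 - s) : ℝ) : ℂ)
  rw [intervalIntegrable_iff_integrableOn_Ioo_of_le (by linarith [pi_pos])] at h
  exact h.congr_fun (fun t ht => (abs_smul_confVec_mul_tan_sub_tan ht hy k).symm) measurableSet_Ioo

/-- Convolution with the Riesz kernel on the line becomes convolution with `sinKer` on the
circle. -/
theorem integral_confVec_mul_rpow_sub (s : ℝ) {k : ℝ → ℂ} (hk : Function.Periodic k π) (y : ℝ) :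
    ∫ x, confVec ((1 + s : ℝ) : ℂ) k x * ((|x - y| ^ (s - 1) : ℝ) : ℂ) =
      confVec ((1 - s : ℝ) : ℂ)
        (fun t' => ∫ t in -(π / 2)..π / 2, k (t + t') * ((sinKer s t : ℝ) : ℂ)) y := by
  have hy := Real.arctan_mem_Ioo y
  conv_lhs => rw [← Real.tan_arctan y]
  conv_rhs => rw [← Real.tan_arctan y, confVec_tan _ _ hy]
  set t' := Real.arctan y
  rw [integral_eq_integral_tan, setIntegral_congr_fun measurableSet_Ioo
    fun t ht => abs_smul_confVec_mul_tan_sub_tan ht hy k, ← integral_Ioc_eq_integral_Ioo,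
    ← intervalIntegral.integral_of_le (by linarith [pi_pos]),
    intervalIntegral.integral_const_mul]
  congr 1
  have hper : Function.Periodic (fun t => k t * ((sinKer s (t - t') : ℝ) : ℂ)) π := fun t => by
    simp only
    rw [hk t, show t + π - t' = t - t' + π by ring, sinKer_periodic s]
  have h1 := hper.intervalIntegral_add_eq (-(π / 2)) (-(π / 2) + t')
  rw [show -(π / 2) + π = π / 2 by ring, show -(π / 2) + t' + π = π / 2 + t' by ring,
    ← intervalIntegral.integral_comp_add_right (fun t => k t * ((sinKer s (t - t') : ℝ) : ℂ))] at h1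
  rw [h1]
  simp

theorem integrable_riesz_prod {s : ℝ} (hs0 : 0 < s) {k : ℝ → ℂ} (hk : Continuous k)
    {B : ℝ} (hB : ∀ t, ‖k t‖ ≤ B) :
    Integrable fun z : ℝ × ℝ => confVec ((1 + s : ℝ) : ℂ) k z.1 *
      conj (confVec ((1 + s : ℝ) : ℂ) k z.2) * ((|z.1 - z.2| ^ (s - 1) : ℝ) : ℂ) := by
  have hB0 : 0 ≤ B := (norm_nonneg _).trans (hB 0)
  have hcont := continuous_confVec ((1 + s : ℝ) : ℂ) hk
  set h₀ := confVec ((1 + s : ℝ) : ℂ) fun _ => 1 with hh₀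
  have hh₀n : ∀ x, ‖h₀ x‖ = (1 + x ^ 2) ^ (-(1 + s) / 2) := fun x => by
    rw [hh₀, norm_confVec]
    simp
  have hle : ∀ x, ‖confVec ((1 + s : ℝ) : ℂ) k x‖ ≤ B * ‖h₀ x‖ := fun x => by
    rw [hh₀n]
    simpa using norm_confVec_le ((1 + s : ℝ) : ℂ) hB x
  have hm : ∀ {p : ℝ → ℂ}, Continuous p → Measurable fun z : ℝ × ℝ =>
      p z.1 * conj (p z.2) * ((|z.1 - z.2| ^ (s - 1) : ℝ) : ℂ) := fun {p} hp => by
    refine Measurable.mul (Continuous.measurable (by fun_prop)) ?_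
    exact Complex.measurable_ofReal.comp (by fun_prop)
  have hh₀c : Continuous h₀ := continuous_confVec _ continuous_const
  have key : Integrable fun z : ℝ × ℝ =>
      h₀ z.1 * conj (h₀ z.2) * ((|z.1 - z.2| ^ (s - 1) : ℝ) : ℂ) := by
    rw [Measure.volume_eq_prod, integrable_prod_iff' (hm hh₀c).aestronglyMeasurable]
    constructor
    · refine Eventually.of_forall fun y => ?_
      have := (integrable_confVec_mul_rpow_sub hs0 (continuous_const (y := (1 : ℂ))) y).const_mul
        (conj (h₀ y))
      refine this.congr (Eventually.of_forall fun x => ?_)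
      simp only [← hh₀]
      ring
    · set c : ℝ := ∫ t in -(π / 2)..π / 2, sinKer s t
      refine ((integrable_one_add_sq_rpow (r := 2) (by norm_num)).const_mul c).congr
        (Eventually.of_forall fun y => ?_)
      have h1 := integral_confVec_mul_rpow_sub s (k := fun _ => (1 : ℂ)) (fun _ => rfl) y
      have h2 : ∀ x, ‖h₀ x * conj (h₀ y) * ((|x - y| ^ (s - 1) : ℝ) : ℂ)‖ =
          ‖h₀ y‖ * (h₀ x * ((|x - y| ^ (s - 1) : ℝ) : ℂ)).re := fun x => by
        rw [norm_mul, norm_mul, RCLike.norm_conj, Complex.norm_real, Complex.re_mul_ofReal, hh₀n x, hh₀n y,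
          hh₀, confVec_ofReal _ _ x, mul_one, Complex.ofReal_re, Real.norm_eq_abs,
          abs_of_nonneg (by positivity)]
        ring
      simp only
      simp_rw [h2]
      rw [integral_const_mul]
      have h3 : ∫ x, (h₀ x * ((|x - y| ^ (s - 1) : ℝ) : ℂ)).re =
          (∫ x, h₀ x * ((|x - y| ^ (s - 1) : ℝ) : ℂ)).re :=
        integral_re (integrable_confVec_mul_rpow_sub hs0 (continuous_const (y := (1 : ℂ))) y)
      rw [h3, h1, confVec_ofReal, hh₀n]
      simp only [one_mul]
      rw [intervalIntegral.integral_ofReal, ← Complex.ofReal_mul, Complex.ofReal_re, ← mul_assoc,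
        ← Real.rpow_add (by positivity), mul_comm c]
      congr 2
      ring
  refine (key.norm.const_mul (B ^ 2)).mono' (hm hcont).aestronglyMeasurable
    (Eventually.of_forall fun z => ?_)
  rw [norm_mul, norm_mul, norm_mul, norm_mul, RCLike.norm_conj, RCLike.norm_conj, ← mul_assoc]
  refine mul_le_mul_of_nonneg_right ?_ (norm_nonneg _)
  calc _ ≤ (B * ‖h₀ z.1‖) * (B * ‖h₀ z.2‖) := by
        gcongr <;> exact hle _
    _ = _ := by ring

theorem integral_riesz_prod {s : ℝ} (hs0 : 0 < s) {k : ℝ → ℂ} (hk : Continuous k)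
    (hper : Function.Periodic k π) {B : ℝ} (hB : ∀ t, ‖k t‖ ≤ B) :
    ∫ z : ℝ × ℝ, confVec ((1 + s : ℝ) : ℂ) k z.1 *
      conj (confVec ((1 + s : ℝ) : ℂ) k z.2) * ((|z.1 - z.2| ^ (s - 1) : ℝ) : ℂ) =
    ∫ t' in -(π / 2)..π / 2,
      (∫ t in -(π / 2)..π / 2, k (t + t') * ((sinKer s t : ℝ) : ℂ)) * conj (k t') := by
  have h := integrable_riesz_prod hs0 hk hB
  rw [Measure.volume_eq_prod] at h ⊢
  rw [integral_prod_symm _ h, ← integral_confVec_mul_conj_confVec s]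
  congr 1 with y
  rw [← integral_confVec_mul_rpow_sub s hper, ← integral_mul_const]
  congr 1 with x
  ring

/-- The `π`-periodic exponential of frequency `m`. -/
def circMode (m : ℤ) (t : ℝ) : ℂ := cexp (2 * m * t * Complex.I)

theorem continuous_circMode (m : ℤ) : Continuous (circMode m) := by
  unfold circMode
  fun_prop

theorem norm_circMode (m : ℤ) (t : ℝ) : ‖circMode m t‖ = 1 := by
  rw [circMode, show (2 * m * t * Complex.I : ℂ) = ((2 * m * t : ℝ) : ℂ) * Complex.I by push_cast; ring,
    Complex.norm_exp_ofReal_mul_I]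

theorem circMode_periodic (m : ℤ) : Function.Periodic (circMode m) π := fun t => by
  rw [circMode, circMode, Complex.exp_eq_exp_iff_exists_int]
  exact ⟨m, by push_cast; ring⟩

theorem circMode_add (m : ℤ) (t t' : ℝ) : circMode m (t + t') = circMode m t * circMode m t' := by
  rw [circMode, circMode, circMode, ← Complex.exp_add]
  push_cast
  ring_nf

theorem conj_circMode (m : ℤ) (t : ℝ) : conj (circMode m t) = circMode (-m) t := by
  rw [circMode, circMode, ← Complex.exp_conj]
  simp only [map_mul, map_ofNat, Complex.conj_ofReal, Complex.conj_I, map_intCast]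
  push_cast
  ring_nf

theorem circMode_mul_circMode (m n : ℤ) (t : ℝ) :
    circMode m t * circMode n t = circMode (m + n) t := by
  rw [circMode, circMode, circMode, ← Complex.exp_add]
  push_cast
  ring_nf

theorem circMode_zero (t : ℝ) : circMode 0 t = 1 := by simp [circMode]

theorem hasDerivAt_circMode (m : ℤ) (t : ℝ) :
    HasDerivAt (circMode m) (2 * m * Complex.I * circMode m t) t := by
  have h : HasDerivAt (fun t : ℝ => (2 * m * t * Complex.I : ℂ)) (2 * m * Complex.I) t := by
    have := ((hasDerivAt_id (t : ℂ)).comp_ofReal.const_mul (2 * m : ℂ)).mul_const Complex.I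
    simpa using this
  exact h.cexp.congr_deriv (mul_comm _ _)

theorem integral_circMode_of_ne {m : ℤ} (hm : m ≠ 0) (a : ℝ) (n : ℕ) :
    ∫ t in a..a + n * π, circMode m t = 0 := by
  have hc : (2 * m * Complex.I : ℂ) ≠ 0 := by simp [hm]
  have h := intervalIntegral.integral_eq_sub_of_hasDerivAt
    (f := fun t => (2 * m * Complex.I : ℂ)⁻¹ * circMode m t) (f' := circMode m) (a := a)
    (b := a + n * π)
    (fun t _ => by
      have := (hasDerivAt_circMode m t).const_mul (2 * m * Complex.I : ℂ)⁻¹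
      rwa [← mul_assoc, inv_mul_cancel₀ hc, one_mul] at this)
    ((continuous_circMode m).intervalIntegrable _ _)
  rw [h, ← ((circMode_periodic m).nat_mul n) a, sub_self]

theorem integral_circMode_mul_conj (m n : ℤ) (a : ℝ) (N : ℕ) :
    ∫ t in a..a + N * π, circMode m t * conj (circMode n t) = if m = n then ((N * π : ℝ) : ℂ) else 0 := by
  simp_rw [conj_circMode, circMode_mul_circMode]
  split_ifs with h
  · subst h
    simp [circMode_zero]
  · exact integral_circMode_of_ne (by omega) a N

/-- The Fourier coefficients of the Riesz kernel on the circle. -/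
def rieszCoeff (s : ℝ) (m : ℤ) : ℂ :=
  ∫ t in -(π / 2)..π / 2, circMode m t * ((sinKer s t : ℝ) : ℂ)

theorem rieszCoeff_eq (s : ℝ) (m : ℤ) :
    rieszCoeff s m = ∫ t in (0 : ℝ)..π, circMode m t * ((sinKer s t : ℝ) : ℂ) := by
  have hper : Function.Periodic (fun t => circMode m t * ((sinKer s t : ℝ) : ℂ)) π := fun t => by
    simp only [circMode_periodic m t, sinKer_periodic s t]
  have h := hper.intervalIntegral_add_eq (-(π / 2)) 0
  rwa [show -(π / 2) + π = π / 2 by ring, zero_add] at h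

theorem norm_rieszCoeff_neg (s : ℝ) (m : ℤ) : ‖rieszCoeff s (-m)‖ = ‖rieszCoeff s m‖ := by
  rw [← RCLike.norm_conj (rieszCoeff s m), rieszCoeff, rieszCoeff,
    intervalIntegral.integral_of_le (by linarith [pi_pos]),
    intervalIntegral.integral_of_le (by linarith [pi_pos]), ← integral_conj]
  simp_rw [map_mul, conj_circMode, Complex.conj_ofReal]

theorem intervalIntegrable_circMode_mul_sinKer {s : ℝ} (hs0 : 0 < s) (m : ℤ) (a b : ℝ) :
    IntervalIntegrable (fun t => circMode m t * ((sinKer s t : ℝ) : ℂ)) volume a b := by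
  simpa using intervalIntegrable_mul_sinKer hs0 (continuous_circMode m) 0 a b

theorem rieszCoeff_succ {s : ℝ} (hs0 : 0 < s) (m : ℤ) :
    (2 * m + 1 + s) * rieszCoeff s (m + 1) = (2 * m + 1 - s) * rieszCoeff s m := by
  set P : ℝ → ℂ := fun t => ((Real.sin t ^ s : ℝ) : ℂ) * cexp ((2 * m + 1) * t * Complex.I) with hP
  set Q : ℝ → ℂ := fun t => (2 * m + 1 + s) / 2 * (circMode (m + 1) t * ((sinKer s t : ℝ) : ℂ)) -
    (2 * m + 1 - s) / 2 * (circMode m t * ((sinKer s t : ℝ) : ℂ)) with hQ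
  have hQi : IntervalIntegrable Q volume 0 π :=
    ((intervalIntegrable_circMode_mul_sinKer hs0 _ _ _).const_mul _).sub
      ((intervalIntegrable_circMode_mul_sinKer hs0 _ _ _).const_mul _)
  have hPc : Continuous P := by
    have h1 : Continuous fun t => Real.sin t ^ s :=
      Real.continuous_sin.rpow_const fun _ => Or.inr hs0.le
    exact (Complex.continuous_ofReal.comp h1).mul (by fun_prop)
  have hderiv : ∀ t ∈ Ioo 0 π, HasDerivAt P (Q t) t := by
    intro t ht
    have hsin := Real.sin_pos_of_mem_Ioo ht
    have h1 := ((Real.hasDerivAt_sin t).rpow_const (p := s) (Or.inl hsin.ne')).ofReal_comp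
    have h2 : HasDerivAt (fun t : ℝ => cexp ((2 * m + 1) * t * Complex.I))
        (cexp ((2 * m + 1) * t * Complex.I) * ((2 * m + 1) * Complex.I)) t := by
      have := ((hasDerivAt_id (t : ℂ)).comp_ofReal.const_mul (2 * m + 1 : ℂ)).mul_const Complex.I
      simp only [id_eq, mul_one] at this
      exact this.cexp
    refine (h1.mul h2).congr_deriv ?_
    have hpow : Real.sin t ^ s = Real.sin t * Real.sin t ^ (s - 1) := by
      rw [← Real.rpow_one_add' hsin.le (by linarith)]
      ring_nf
    rw [hQ]
    simp only
    rw [sinKer, abs_of_pos hsin, hpow, circMode, circMode]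
    set z := cexp ((2 * m + 1) * t * Complex.I)
    have e1 : cexp (2 * ((m + 1 : ℤ) : ℂ) * t * Complex.I) = z * cexp (t * Complex.I) := by
      rw [← Complex.exp_add]
      push_cast
      ring_nf
    have e2 : cexp (2 * (m : ℂ) * t * Complex.I) = z * cexp (-(t : ℂ) * Complex.I) := by
      rw [← Complex.exp_add]
      ring_nf
    rw [e1, e2, Complex.exp_mul_I, Complex.exp_mul_I, Complex.cos_neg, Complex.sin_neg]
    push_cast
    ring
  have h := intervalIntegral.integral_eq_sub_of_hasDerivAt_of_le pi_pos.le hPc.continuousOn hderiv hQi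
  have hP0 : P π - P 0 = 0 := by simp [hP, Real.zero_rpow hs0.ne']
  rw [hP0, hQ, intervalIntegral.integral_sub
    ((intervalIntegrable_circMode_mul_sinKer hs0 _ _ _).const_mul _)
    ((intervalIntegrable_circMode_mul_sinKer hs0 _ _ _).const_mul _),
    intervalIntegral.integral_const_mul, intervalIntegral.integral_const_mul, ← rieszCoeff_eq,
    ← rieszCoeff_eq] at h
  linear_combination 2 * h

/-- The Sobolev weight attached to the frequency `m`. -/
def modeWeight (s : ℝ) (m : ℤ) : ℝ := (1 + |(m : ℝ)|) ^ s

theorem modeWeight_pos (s : ℝ) (m : ℤ) : 0 < modeWeight s m := by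
  unfold modeWeight
  positivity

theorem norm_rieszCoeff_natCast_mul_le {s : ℝ} (hs0 : 0 < s) (hs1 : s < 1) (n : ℕ) :
    ‖rieszCoeff s n‖ * (1 + n) ^ s ≤ ‖rieszCoeff s 0‖ := by
  induction n with
  | zero => simp
  | succ n ih =>
    refine le_trans ?_ ih
    have hrec := congrArg norm (rieszCoeff_succ hs0 (n : ℤ))
    rw [norm_mul, norm_mul] at hrec
    have e1 : ‖(2 * ((n : ℤ) : ℂ) + 1 + s)‖ = 2 * n + 1 + s := by
      rw [show (2 * ((n : ℤ) : ℂ) + 1 + s) = ((2 * n + 1 + s : ℝ) : ℂ) by push_cast; ring,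
        Complex.norm_real, Real.norm_eq_abs, abs_of_pos (by positivity)]
    have hn : (0 : ℝ) ≤ n := n.cast_nonneg
    have e2 : ‖(2 * ((n : ℤ) : ℂ) + 1 - s)‖ = 2 * n + 1 - s := by
      rw [show (2 * ((n : ℤ) : ℂ) + 1 - s) = ((2 * n + 1 - s : ℝ) : ℂ) by push_cast; ring,
        Complex.norm_real, Real.norm_eq_abs, abs_of_pos (by linarith)]
    rw [e1, e2] at hrec
    have hb : ((1 : ℝ) + (n + 1 : ℕ)) ^ s ≤ (1 + n) ^ s * (1 + s * (1 / (1 + n))) := by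
      have h1 : ((1 : ℝ) + (n + 1 : ℕ)) = (1 + n) * (1 + 1 / (1 + n)) := by
        push_cast
        field_simp
        ring
      rw [h1, Real.mul_rpow (by positivity) (by positivity)]
      gcongr
      exact rpow_one_add_le_one_add_mul_self (by
        have : (0 : ℝ) ≤ 1 / (1 + n) := by positivity
        linarith) hs0.le hs1.le
    have hpos : 0 < 2 * (n : ℝ) + 1 + s := by positivity
    have hE : ‖rieszCoeff s ((n : ℤ) + 1)‖ = (2 * n + 1 - s) / (2 * n + 1 + s) * ‖rieszCoeff s n‖ := by
      field_simp
      linarith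
    push_cast at hb ⊢
    rw [hE]
    calc (2 * (n : ℝ) + 1 - s) / (2 * n + 1 + s) * ‖rieszCoeff s n‖ * (1 + (n + 1)) ^ s
        ≤ (2 * (n : ℝ) + 1 - s) / (2 * n + 1 + s) * ‖rieszCoeff s n‖ *
            ((1 + n) ^ s * (1 + s * (1 / (1 + n)))) := by
          have : 0 ≤ (2 * (n : ℝ) + 1 - s) / (2 * n + 1 + s) := by
            apply div_nonneg <;> linarith
          gcongr
      _ = ((2 * (n : ℝ) + 1 - s) / (2 * n + 1 + s) * (1 + s * (1 / (1 + n)))) *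
            (‖rieszCoeff s n‖ * (1 + n) ^ s) := by ring
      _ ≤ 1 * (‖rieszCoeff s n‖ * (1 + n) ^ s) := by
          gcongr
          rw [show 1 + s * (1 / (1 + (n : ℝ))) = (1 + n + s) / (1 + n) by field_simp,
            div_mul_div_comm, div_le_one (by positivity)]
          nlinarith
      _ = _ := one_mul _

theorem norm_rieszCoeff_mul_le {s : ℝ} (hs0 : 0 < s) (hs1 : s < 1) (m : ℤ) :
    ‖rieszCoeff s m‖ * modeWeight s m ≤ ‖rieszCoeff s 0‖ := by
  obtain ⟨n, rfl | rfl⟩ := m.eq_nat_or_neg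
  · simpa [modeWeight] using norm_rieszCoeff_natCast_mul_le hs0 hs1 n
  · rw [norm_rieszCoeff_neg]
    simpa [modeWeight] using norm_rieszCoeff_natCast_mul_le hs0 hs1 n

/-- The trigonometric polynomial with coefficients `a` on the finite set `S`. -/
def trigPoly (S : Finset ℤ) (a : ℤ → ℂ) (t : ℝ) : ℂ := ∑ m ∈ S, a m * circMode m t

theorem continuous_trigPoly (S : Finset ℤ) (a : ℤ → ℂ) : Continuous (trigPoly S a) := by
  unfold trigPoly
  exact continuous_finsetSum _ fun m _ => continuous_const.mul (continuous_circMode m)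

theorem trigPoly_periodic (S : Finset ℤ) (a : ℤ → ℂ) : Function.Periodic (trigPoly S a) π :=
  fun t => by simp [trigPoly, circMode_periodic _ t]

theorem norm_trigPoly_le (S : Finset ℤ) (a : ℤ → ℂ) (t : ℝ) : ‖trigPoly S a t‖ ≤ ∑ m ∈ S, ‖a m‖ := by
  refine (norm_sum_le _ _).trans_eq (Finset.sum_congr rfl fun m _ => ?_)
  rw [norm_mul, norm_circMode, mul_one]

theorem hasDerivAt_trigPoly (S : Finset ℤ) (a : ℤ → ℂ) (t : ℝ) :
    HasDerivAt (trigPoly S a) (trigPoly S (fun m => 2 * m * Complex.I * a m) t) t := by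
  have h := HasDerivAt.fun_sum (u := S) fun m _ => (hasDerivAt_circMode m t).const_mul (a m)
  refine h.congr_deriv (Finset.sum_congr rfl fun m _ => ?_)
  ring

theorem integral_trigPoly_mul_conj (S : Finset ℤ) (a b : ℤ → ℂ) (x : ℝ) (N : ℕ) :
    ∫ t in x..x + N * π, trigPoly S a t * conj (trigPoly S b t) =
      (N * π : ℝ) * ∑ m ∈ S, a m * conj (b m) := by
  have h1 : ∀ t, trigPoly S a t * conj (trigPoly S b t) =
      ∑ m ∈ S, ∑ n ∈ S, a m * conj (b n) * (circMode m t * conj (circMode n t)) := fun t => by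
    rw [trigPoly, trigPoly, map_sum, Finset.sum_mul_sum]
    refine Finset.sum_congr rfl fun m _ => Finset.sum_congr rfl fun n _ => ?_
    rw [map_mul]
    ring
  have hc : ∀ m n, Continuous fun t => a m * conj (b n) * (circMode m t * conj (circMode n t)) := by
    intro m n
    have := continuous_circMode m
    have := continuous_circMode n
    fun_prop
  simp_rw [h1]
  rw [intervalIntegral.integral_finsetSum fun m _ =>
    (continuous_finsetSum _ fun n _ => hc m n).intervalIntegrable _ _, Finset.mul_sum]
  refine Finset.sum_congr rfl fun m hm => ?_
  rw [intervalIntegral.integral_finsetSum fun n _ => (hc m n).intervalIntegrable _ _]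
  simp_rw [intervalIntegral.integral_const_mul, integral_circMode_mul_conj]
  simp [hm]
  ring

theorem integral_trigPoly_mul_sinKer {s : ℝ} (hs0 : 0 < s) (S : Finset ℤ) (a : ℤ → ℂ) (t' : ℝ) :
    ∫ t in -(π / 2)..π / 2, trigPoly S a (t + t') * ((sinKer s t : ℝ) : ℂ) =
      trigPoly S (fun m => a m * rieszCoeff s m) t' := by
  have h1 : ∀ t, trigPoly S a (t + t') * ((sinKer s t : ℝ) : ℂ) =
      ∑ m ∈ S, a m * circMode m t' * (circMode m t * ((sinKer s t : ℝ) : ℂ)) := fun t => by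
    rw [trigPoly, Finset.sum_mul]
    refine Finset.sum_congr rfl fun m _ => ?_
    rw [circMode_add]
    ring
  simp_rw [h1]
  rw [intervalIntegral.integral_finsetSum fun m _ =>
    (intervalIntegrable_circMode_mul_sinKer hs0 m _ _).const_mul _, trigPoly]
  refine Finset.sum_congr rfl fun m _ => ?_
  rw [intervalIntegral.integral_const_mul, ← rieszCoeff]
  ring

theorem norm_integral_riesz_trigPoly_le {s : ℝ} (hs0 : 0 < s) (hs1 : s < 1) (S : Finset ℤ)
    (a : ℤ → ℂ) :
    ‖∫ z : ℝ × ℝ, confVec ((1 + s : ℝ) : ℂ) (trigPoly S a) z.1 *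
      conj (confVec ((1 + s : ℝ) : ℂ) (trigPoly S a) z.2) * ((|z.1 - z.2| ^ (s - 1) : ℝ) : ℂ)‖ ≤
    π * ‖rieszCoeff s 0‖ * ∑ m ∈ S, ‖a m‖ ^ 2 * (modeWeight s m)⁻¹ := by
  rw [integral_riesz_prod hs0 (continuous_trigPoly S a) (trigPoly_periodic S a)
    (norm_trigPoly_le S a)]
  simp_rw [integral_trigPoly_mul_sinKer hs0]
  have h := integral_trigPoly_mul_conj S (fun m => a m * rieszCoeff s m) a (-(π / 2)) 1
  rw [Nat.cast_one, one_mul, show -(π / 2) + π = π / 2 by ring] at h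
  rw [h, norm_mul, Complex.norm_real, Real.norm_eq_abs, abs_of_pos pi_pos, mul_assoc]
  gcongr
  rw [Finset.mul_sum]
  refine (norm_sum_le _ _).trans (Finset.sum_le_sum fun m _ => ?_)
  have hw := modeWeight_pos s m
  rw [norm_mul, norm_mul, RCLike.norm_conj]
  have h2 : ‖rieszCoeff s m‖ ≤ ‖rieszCoeff s 0‖ * (modeWeight s m)⁻¹ := by
    rw [← div_eq_mul_inv, le_div_iff₀ hw]
    exact norm_rieszCoeff_mul_le hs0 hs1 m
  calc _ = ‖a m‖ ^ 2 * ‖rieszCoeff s m‖ := by ring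
    _ ≤ ‖a m‖ ^ 2 * (‖rieszCoeff s 0‖ * (modeWeight s m)⁻¹) := by gcongr
    _ = _ := by ring

theorem ftKernel_comm (ξ x : ℝ) : ftKernel ξ x = ftKernel x ξ := by
  unfold ftKernel
  ring_nf

theorem conj_ftKernel (ξ x : ℝ) : conj (ftKernel ξ x) = ftKernel ξ (-x) := by
  unfold ftKernel
  rw [← Complex.exp_conj]
  simp only [map_mul, map_neg, map_ofNat, Complex.conj_ofReal, Complex.conj_I]
  push_cast
  ring_nf

theorem integral_fourier_mul {f g : ℝ → ℂ} (hf : Integrable f) (hg : Integrable g) :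
    ∫ ξ, 𝓕 f ξ * g ξ = ∫ x, f x * 𝓕 g x := by
  have hi : Integrable (fun w : ℝ × ℝ => f w.2 * ftKernel w.1 w.2 * g w.1) := by
    have h1 := (hg.mul_prod hf).mul_bdd (c := 1) (g := fun w : ℝ × ℝ => ftKernel w.1 w.2)
      (by
        refine Continuous.aestronglyMeasurable ?_
        unfold ftKernel
        fun_prop) (Eventually.of_forall fun w => (norm_ftKernel _ _).le)
    refine h1.congr (Eventually.of_forall fun w => ?_)
    simp only
    ring
  simp_rw [fourier_eq_integral_ftKernel, ← integral_mul_const, ← integral_const_mul]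
  rw [integral_integral_swap hi]
  congr 1 with x
  congr 1 with ξ
  rw [ftKernel_comm]
  ring

theorem fourier_conj_fourier {h : ℝ → ℂ} (hc : Continuous h) (hi : Integrable h)
    (hF : Integrable (𝓕 h)) (x : ℝ) : 𝓕 (fun ξ => conj (𝓕 h ξ)) x = conj (h x) := by
  conv_rhs => rw [← hc.fourierInv_fourier_eq hi hF, Real.fourierInv_eq_fourier_neg]
  rw [fourier_eq_integral_ftKernel, fourier_eq_integral_ftKernel, ← integral_conj]
  congr 1 with ξ
  rw [map_mul, ftKernel_comm (-x) ξ, ← conj_ftKernel, Complex.conj_conj, ftKernel_comm ξ x]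

theorem norm_fourier_le_of_second_deriv {h h' h'' : ℝ → ℂ} (hd : ∀ x, HasDerivAt h (h' x) x)
    (hd' : ∀ x, HasDerivAt h' (h'' x) x) (hi : Integrable h) (hi' : Integrable h')
    (hi'' : Integrable h'') : ∃ D, ∀ ξ, ‖𝓕 h ξ‖ ≤ D * (1 + ξ ^ 2)⁻¹ := by
  have e1 : deriv h = h' := funext fun x => (hd x).deriv
  have e2 : deriv h' = h'' := funext fun x => (hd' x).deriv
  refine ⟨(∫ x, ‖h x‖) + ∫ x, ‖h'' x‖, fun ξ => ?_⟩
  have h1 := congrFun (Real.fourier_deriv hi (fun x => (hd x).differentiableAt) (e1 ▸ hi')) ξ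
  have h2 := congrFun (Real.fourier_deriv hi' (fun x => (hd' x).differentiableAt) (e2 ▸ hi'')) ξ
  rw [e1] at h1
  rw [e2, h1] at h2
  have h3 := norm_fourier_le h'' ξ
  have h4 := norm_fourier_le h ξ
  simp only [smul_eq_mul] at h2
  rw [h2, norm_mul (2 * π * Complex.I * ξ), norm_mul (2 * π * Complex.I * ξ),
    norm_two_pi_I_mul] at h3
  rw [← div_eq_mul_inv, le_div_iff₀ (by positivity), mul_add, mul_one]
  refine add_le_add h4 (le_trans ?_ h3)
  have hpi : 1 ≤ 2 * π := by linarith [pi_gt_three]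
  calc ‖𝓕 h ξ‖ * ξ ^ 2 = 1 * |ξ| * (1 * |ξ| * ‖𝓕 h ξ‖) := by rw [← sq_abs]; ring
    _ ≤ _ := by gcongr

theorem integrable_rpow_mul_inv_one_add_sq {s : ℝ} (hs0 : 0 < s) (hs1 : s < 1) :
    Integrable fun ξ : ℝ => |ξ| ^ (-s) * (1 + ξ ^ 2)⁻¹ := by
  have h0 : IntervalIntegrable (fun ξ : ℝ => |ξ| ^ (-s)) volume 0 1 := by
    refine (intervalIntegral.intervalIntegrable_rpow' (r := -s) (by linarith)).congr fun x hx => ?_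
    rw [uIoc_of_le zero_le_one] at hx
    simp only [abs_of_pos hx.1]
  have h0' : IntervalIntegrable (fun ξ : ℝ => |ξ| ^ (-s)) volume (-1) 0 := by
    rw [IntervalIntegrable.iff_comp_neg]
    simpa using h0.symm
  have h1 : IntegrableOn (fun ξ : ℝ => |ξ| ^ (-s)) (Ioc (-1) 1) :=
    (intervalIntegrable_iff_integrableOn_Ioc_of_le (by norm_num)).1 (h0'.trans h0)
  have h2 := (h1.integrable_indicator measurableSet_Ioc).add
    (integrable_one_add_sq_rpow (r := 2) (by norm_num))
  refine h2.mono' (by fun_prop) (Eventually.of_forall fun ξ => ?_)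
  rw [Real.norm_eq_abs, abs_of_nonneg (by positivity), Pi.add_apply,
    show (-2 / 2 : ℝ) = -1 by norm_num, Real.rpow_neg_one]
  by_cases hξ : ξ ∈ Ioc (-1 : ℝ) 1
  · rw [indicator_of_mem hξ]
    have : (1 + ξ ^ 2)⁻¹ ≤ 1 := inv_le_one_of_one_le₀ (by nlinarith [sq_nonneg ξ])
    have h3 : |ξ| ^ (-s) * (1 + ξ ^ 2)⁻¹ ≤ |ξ| ^ (-s) * 1 := by gcongr
    have : 0 ≤ (1 + ξ ^ 2)⁻¹ := by positivity
    linarith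
  · rw [indicator_of_notMem hξ, zero_add]
    have h4 : 1 ≤ |ξ| := by
      by_contra hlt
      push Not at hlt
      rw [abs_lt] at hlt
      exact hξ ⟨hlt.1, hlt.2.le⟩
    have : |ξ| ^ (-s) ≤ 1 := Real.rpow_le_one_of_one_le_of_nonpos h4 (by linarith)
    calc _ ≤ 1 * (1 + ξ ^ 2)⁻¹ := by gcongr
      _ = _ := one_mul _

theorem exists_norm_fourier_confVec_le {s : ℝ} (hs0 : 0 < s) {k k' k'' : ℝ → ℂ}
    (hk : ∀ t, HasDerivAt k (k' t) t) (hk' : ∀ t, HasDerivAt k' (k'' t) t)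
    (hc'' : Continuous k'') {B B' B'' : ℝ} (hB : ∀ t, ‖k t‖ ≤ B) (hB' : ∀ t, ‖k' t‖ ≤ B')
    (hB'' : ∀ t, ‖k'' t‖ ≤ B'') :
    ∃ D, ∀ ξ, ‖𝓕 (confVec ((1 + s : ℝ) : ℂ) k) ξ‖ ≤ D * (1 + ξ ^ 2)⁻¹ := by
  have hkc : Continuous k := continuous_iff_continuousAt.2 fun t => (hk t).continuousAt
  have hk'c : Continuous k' := continuous_iff_continuousAt.2 fun t => (hk' t).continuousAt
  set a : ℂ := ((1 + s : ℝ) : ℂ)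
  have ha : a.re = 1 + s := Complex.ofReal_re _
  set p := derivProfile a k k' with hp
  set p' : ℝ → ℂ := fun t => -a * Real.cos t * k t - (a + 1) * Real.sin t * k' t + Real.cos t * k'' t
    with hp'
  have hpd : ∀ t, HasDerivAt p (p' t) t := fun t => by
    have h1 := ((Real.hasDerivAt_sin t).ofReal_comp.const_mul (-a)).mul (hk t)
    have h2 := (Real.hasDerivAt_cos t).ofReal_comp.mul (hk' t)
    refine (h1.add h2).congr_deriv ?_
    rw [hp']
    push_cast
    ring
  have hp'c : Continuous p' := by fun_prop
  have hpc : Continuous p := continuous_derivProfile a hkc hk'c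
  have hpB := norm_derivProfile_le a hB hB'
  have hp'B : ∀ t, ‖p' t‖ ≤ ‖a‖ * B + ‖a + 1‖ * B' + B'' := fun t => by
    have hc := Real.abs_cos_le_one t
    have hs := Real.abs_sin_le_one t
    have n1 : ‖-a * Real.cos t * k t‖ ≤ ‖a‖ * 1 * B := by
      rw [norm_mul, norm_mul, norm_neg, Complex.norm_real (Real.cos t), Real.norm_eq_abs]
      gcongr
      exact hB t
    have n2 : ‖(a + 1) * Real.sin t * k' t‖ ≤ ‖a + 1‖ * 1 * B' := by
      rw [norm_mul, norm_mul, Complex.norm_real (Real.sin t), Real.norm_eq_abs]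
      gcongr
      exact hB' t
    have n3 : ‖(Real.cos t : ℂ) * k'' t‖ ≤ 1 * B'' := by
      rw [norm_mul, Complex.norm_real, Real.norm_eq_abs]
      gcongr
      exact hB'' t
    calc _ ≤ _ := norm_add_le _ _
      _ ≤ _ := add_le_add (norm_sub_le _ _) le_rfl
      _ ≤ _ := by linarith
  exact norm_fourier_le_of_second_deriv (hasDerivAt_confVec a hk) (hasDerivAt_confVec (a + 1) hpd)
    (integrable_confVec (by rw [ha]; linarith) hkc hB)
    (integrable_confVec (by rw [Complex.add_re, ha, Complex.one_re]; linarith) hpc hpB)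
    (integrable_confVec (by simp only [Complex.add_re, ha, Complex.one_re]; linarith)
      (continuous_derivProfile _ hpc hp'c) (norm_derivProfile_le _ hpB hp'B))

/-- Parseval pairing of a slowly decaying conformal vector with a rapidly decaying one. -/
theorem integral_confVec_mul_conj_eq_fourier {s : ℝ} (hs0 : 0 < s) (hs1 : s < 1)
    {k k' : ℝ → ℂ} (hk : ∀ t, HasDerivAt k (k' t) t) (hk'c : Continuous k') {B B' : ℝ}
    (hB : ∀ t, ‖k t‖ ≤ B) (hB' : ∀ t, ‖k' t‖ ≤ B') {h : ℝ → ℂ} (hc : Continuous h)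
    (hi : Integrable h) {D : ℝ} (hD : ∀ ξ, ‖𝓕 h ξ‖ ≤ D * (1 + ξ ^ 2)⁻¹) :
    ∫ x, confVec ((1 - s : ℝ) : ℂ) k x * conj (h x) =
      ∫ ξ, impFT (confVec (((1 - s : ℝ) : ℂ) + 1) (derivProfile ((1 - s : ℝ) : ℂ) k k')) ξ *
        conj (𝓕 h ξ) := by
  have hkc : Continuous k := continuous_iff_continuousAt.2 fun t => (hk t).continuousAt
  have hFc := continuous_fourier hi
  set a : ℂ := ((1 - s : ℝ) : ℂ)
  have ha : a.re = 1 - s := Complex.ofReal_re _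
  have hfc : Continuous (confVec a k) := continuous_confVec a hkc
  have hfB : ∀ x, ‖confVec a k x‖ ≤ B := fun x => by
    have hB0 : 0 ≤ B := (norm_nonneg _).trans (hB 0)
    have h1 := norm_confVec_le a hB x
    refine h1.trans (mul_le_of_le_one_right hB0 ?_)
    exact Real.rpow_le_one_of_one_le_of_nonpos (by nlinarith [sq_nonneg x]) (by rw [ha]; linarith)
  have hFi : Integrable (𝓕 h) := by
    refine ((integrable_one_add_sq_rpow (r := 2) (by norm_num)).const_mul D).mono'
      hFc.aestronglyMeasurable (Eventually.of_forall fun ξ => ?_)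
    rw [show (-2 / 2 : ℝ) = -1 by norm_num, Real.rpow_neg_one]
    exact hD ξ
  have hconj : ∀ {p : ℝ → ℂ}, Integrable p → Integrable fun x => conj (p x) := fun hp =>
    (Complex.conjLIE.toContinuousLinearEquiv.integrable_comp_iff).2 hp
  set f : ℕ → ℝ → ℂ := fun n => (Ioc (-((n : ℝ) + 1)) ((n : ℝ) + 1)).indicator (confVec a k) with hf
  have hfi : ∀ n, Integrable (f n) := fun n =>
    (integrable_indicator_iff measurableSet_Ioc).2 (hfc.integrableOn_Ioc)
  have hpars : ∀ n, ∫ x, f n x * conj (h x) = ∫ ξ, 𝓕 (f n) ξ * conj (𝓕 h ξ) := fun n => by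
    rw [integral_fourier_mul (hfi n) (hconj hFi)]
    congr 1 with x
    rw [fourier_conj_fourier hc hi hFi]
  have hatTop : Tendsto (fun n : ℕ => (n : ℝ) + 1) atTop atTop :=
    tendsto_atTop_add_const_right _ _ tendsto_natCast_atTop_atTop
  have hlim1 : Tendsto (fun n => ∫ x, f n x * conj (h x)) atTop
      (nhds (∫ x, confVec a k x * conj (h x))) := by
    refine tendsto_integral_of_dominated_convergence (fun x => B * ‖h x‖) (fun n => ?_)
      (hi.norm.const_mul B) (fun n => Eventually.of_forall fun x => ?_)
      (Eventually.of_forall fun x => ?_)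
    · exact (hfi n).1.mul (hconj hi).1
    · rw [norm_mul, RCLike.norm_conj]
      gcongr
      exact (norm_indicator_le_norm_self _ _).trans (hfB x)
    · refine Tendsto.mul_const _ (tendsto_const_nhds.congr' ?_)
      filter_upwards [hatTop.eventually_gt_atTop |x|] with n hn
      rw [hf]
      simp only
      rw [abs_lt] at hn
      rw [indicator_of_mem (show x ∈ Ioc (-((n : ℝ) + 1)) ((n : ℝ) + 1) from ⟨hn.1, hn.2.le⟩)]
  obtain ⟨C, hC⟩ := exists_norm_integral_confVec_le hs0 hs1 hk hk'c hB hB'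
  have ha' : (1 - (s : ℂ)) = a := by simp [a]
  have hlim2 : Tendsto (fun n => ∫ ξ, 𝓕 (f n) ξ * conj (𝓕 h ξ)) atTop
      (nhds (∫ ξ, impFT (confVec (a + 1) (derivProfile a k k')) ξ * conj (𝓕 h ξ))) := by
    refine tendsto_integral_of_dominated_convergence
      (fun ξ => C * D * (|ξ| ^ (-s) * (1 + ξ ^ 2)⁻¹)) (fun n => ?_)
      ((integrable_rpow_mul_inv_one_add_sq hs0 hs1).const_mul _) (fun n => ?_) ?_
    · exact (continuous_fourier (hfi n)).aestronglyMeasurable.mul (hconj hFi).1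
    · filter_upwards [compl_mem_ae_iff.2 (measure_singleton (0 : ℝ))] with ξ hξ
      have h1 := hC ((n : ℝ) + 1) (by positivity) ξ hξ
      rw [intervalIntegral.integral_of_le (by linarith [show (0 : ℝ) ≤ n from n.cast_nonneg]),
        ← fourier_indicator _ measurableSet_Ioc, ha'] at h1
      rw [norm_mul, RCLike.norm_conj]
      calc _ ≤ C * |ξ| ^ (-s) * (D * (1 + ξ ^ 2)⁻¹) :=
            mul_le_mul h1 (hD ξ) (norm_nonneg _) ((norm_nonneg _).trans h1)
        _ = _ := by ring
    · filter_upwards [compl_mem_ae_iff.2 (measure_singleton (0 : ℝ))] with ξ hξ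
      refine Tendsto.mul_const _ ?_
      have h1 := isImpFT_confVec (a := a) (by rw [ha]; linarith) hk hk'c hB hB' (show ξ ≠ 0 from hξ)
      refine (h1.comp hatTop).congr fun n => ?_
      rw [hf]
      simp only
      rw [fourier_indicator _ measurableSet_Ioc]
      rfl
  refine tendsto_nhds_unique hlim1 ?_
  simp_rw [hpars]
  exact hlim2

/-- The Fourier coefficient of a `π`-periodic function. -/
def modeCoeff (k : ℝ → ℂ) (m : ℤ) : ℂ := (π : ℂ)⁻¹ * ∫ t in -(π / 2)..π / 2, k t * conj (circMode m t)

theorem integral_mul_conj_trigPoly {k : ℝ → ℂ} (hk : Continuous k) (S : Finset ℤ) (a : ℤ → ℂ) :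
    ∫ t in -(π / 2)..π / 2, k t * conj (trigPoly S a t) =
      π * ∑ m ∈ S, modeCoeff k m * conj (a m) := by
  have hc : ∀ m, Continuous fun t => conj (a m) * (k t * conj (circMode m t)) := fun m => by
    have := continuous_circMode m
    fun_prop
  have h1 : ∀ t, k t * conj (trigPoly S a t) =
      ∑ m ∈ S, conj (a m) * (k t * conj (circMode m t)) := fun t => by
    rw [trigPoly, map_sum, Finset.mul_sum]
    refine Finset.sum_congr rfl fun m _ => ?_
    rw [map_mul]
    ring
  simp_rw [h1]
  rw [intervalIntegral.integral_finsetSum fun m _ => (hc m).intervalIntegrable _ _, Finset.mul_sum]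
  refine Finset.sum_congr rfl fun m _ => ?_
  have hpi : (π : ℂ) ≠ 0 := by exact_mod_cast pi_pos.ne'
  rw [intervalIntegral.integral_const_mul, modeCoeff]
  field_simp

theorem ofReal_norm_integral_mul_conj_sq_le {s : ℝ} {G H : ℝ → ℂ} (hG : Measurable G)
    (hH : Measurable H) :
    ENNReal.ofReal (‖∫ ξ, G ξ * conj (H ξ)‖ ^ 2) ≤
      (∫⁻ ξ, ENNReal.ofReal (|ξ| ^ s * ‖G ξ‖ ^ 2)) *
        ∫⁻ ξ, ENNReal.ofReal (|ξ| ^ (-s) * ‖H ξ‖ ^ 2) := by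
  set p : ℝ → ℝ≥0∞ := fun ξ => ENNReal.ofReal (|ξ| ^ (s / 2) * ‖G ξ‖) with hp
  set q : ℝ → ℝ≥0∞ := fun ξ => ENNReal.ofReal (|ξ| ^ (-s / 2) * ‖H ξ‖) with hq
  have hp2 : ∀ ξ, p ξ ^ (2 : ℝ) = ENNReal.ofReal (|ξ| ^ s * ‖G ξ‖ ^ 2) := fun ξ => by
    rw [hp]
    simp only
    rw [ENNReal.ofReal_rpow_of_nonneg (by positivity) (by norm_num), Real.rpow_ofNat, mul_pow,
      ← Real.rpow_natCast (|ξ| ^ (s / 2)), ← Real.rpow_mul (abs_nonneg ξ)]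
    norm_num
  have hq2 : ∀ ξ, q ξ ^ (2 : ℝ) = ENNReal.ofReal (|ξ| ^ (-s) * ‖H ξ‖ ^ 2) := fun ξ => by
    rw [hq]
    simp only
    rw [ENNReal.ofReal_rpow_of_nonneg (by positivity) (by norm_num), Real.rpow_ofNat, mul_pow,
      ← Real.rpow_natCast (|ξ| ^ (-s / 2)), ← Real.rpow_mul (abs_nonneg ξ)]
    norm_num
  have hCS := ENNReal.lintegral_mul_le_Lp_mul_Lq (volume : Measure ℝ) Real.HolderConjugate.two_two
    (f := p) (g := q) (by fun_prop) (by fun_prop)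
  simp_rw [hp2, hq2] at hCS
  have h1 : ENNReal.ofReal ‖∫ ξ, G ξ * conj (H ξ)‖ ≤ ∫⁻ ξ, (p * q) ξ := by
    rw [ofReal_norm]
    refine (enorm_integral_le_lintegral_enorm _).trans (lintegral_mono_ae ?_)
    filter_upwards [compl_mem_ae_iff.2 (measure_singleton (0 : ℝ))] with ξ hξ
    have hξ' : 0 < |ξ| := abs_pos.2 hξ
    have : |ξ| ^ (s / 2) * |ξ| ^ (-s / 2) = 1 := by
      rw [← Real.rpow_add hξ']
      ring_nf
      exact Real.rpow_zero _
    rw [← ofReal_norm, Pi.mul_apply, hp, hq, ← ENNReal.ofReal_mul (by positivity), norm_mul,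
      RCLike.norm_conj]
    refine ENNReal.ofReal_le_ofReal (le_of_eq ?_)
    linear_combination (-(‖G ξ‖ * ‖H ξ‖)) * this
  have h2 := pow_le_pow_left' (h1.trans hCS) 2
  rw [← ENNReal.ofReal_pow (norm_nonneg _)] at h2
  refine h2.trans (le_of_eq ?_)
  rw [mul_pow, ← ENNReal.rpow_natCast, ← ENNReal.rpow_natCast, ← ENNReal.rpow_mul,
    ← ENNReal.rpow_mul]
  norm_num

/-- The constant in the lower bound of the complementary-series norm. -/
def dualityConst (s : ℝ) : ℝ := rieszConst s * (‖rieszCoeff s 0‖ / π)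

theorem sum_modeCoeff_le {s : ℝ} (hs0 : 0 < s) (hs1 : s < 1)
    {k k' : ℝ → ℂ} (hk : ∀ t, HasDerivAt k (k' t) t) (hk'c : Continuous k') {B B' : ℝ}
    (hB : ∀ t, ‖k t‖ ≤ B) (hB' : ∀ t, ‖k' t‖ ≤ B') (S : Finset ℤ) :
    ENNReal.ofReal (∑ m ∈ S, ‖modeCoeff k m‖ ^ 2 * modeWeight s m) ≤
      ENNReal.ofReal (dualityConst s) * ∫⁻ ξ, ENNReal.ofReal (|ξ| ^ s *
        ‖impFT (confVec (((1 - s : ℝ) : ℂ) + 1) (derivProfile ((1 - s : ℝ) : ℂ) k k')) ξ‖ ^ 2) := by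
  have hkc : Continuous k := continuous_iff_continuousAt.2 fun t => (hk t).continuousAt
  set a : ℤ → ℂ := fun m => modeCoeff k m * (modeWeight s m : ℂ) with ha
  set h := confVec ((1 + s : ℝ) : ℂ) (trigPoly S a) with hh
  have hpc := continuous_trigPoly S a
  have hre : (((1 + s : ℝ) : ℂ)).re = 1 + s := Complex.ofReal_re _
  have hhc : Continuous h := continuous_confVec _ hpc
  have hhi : Integrable h := integrable_confVec (by rw [hre]; linarith) hpc (norm_trigPoly_le S a)
  obtain ⟨D, hD⟩ := exists_norm_fourier_confVec_le hs0 (hasDerivAt_trigPoly S a)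
    (hasDerivAt_trigPoly S _) (continuous_trigPoly S _) (norm_trigPoly_le S a)
    (norm_trigPoly_le S _) (norm_trigPoly_le S _)
  have hGm : Measurable
      (impFT (confVec (((1 - s : ℝ) : ℂ) + 1) (derivProfile ((1 - s : ℝ) : ℂ) k k'))) :=
    measurable_impFT (integrable_confVec (by simp [hs1]) (continuous_derivProfile _ hkc hk'c)
      (norm_derivProfile_le _ hB hB'))
  have hpair := integral_confVec_mul_conj_eq_fourier hs0 hs1 hk hk'c hB hB' hhc hhi hD
  rw [integral_confVec_mul_conj_confVec, integral_mul_conj_trigPoly hkc] at hpair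
  set A := ∑ m ∈ S, ‖modeCoeff k m‖ ^ 2 * modeWeight s m with hA
  have hA0 : 0 ≤ A := Finset.sum_nonneg fun m _ => mul_nonneg (by positivity) (modeWeight_pos s m).le
  have hsum : ∑ m ∈ S, modeCoeff k m * conj (a m) = (A : ℂ) := by
    rw [hA]
    push_cast
    refine Finset.sum_congr rfl fun m _ => ?_
    rw [ha]
    simp only
    rw [map_mul, Complex.conj_ofReal, ← mul_assoc, Complex.mul_conj, Complex.normSq_eq_norm_sq]
    push_cast
    ring
  have hsum2 : ∑ m ∈ S, ‖a m‖ ^ 2 * (modeWeight s m)⁻¹ = A := by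
    refine Finset.sum_congr rfl fun m _ => ?_
    have hw := modeWeight_pos s m
    rw [ha]
    simp only
    rw [norm_mul, Complex.norm_real, Real.norm_eq_abs, abs_of_pos hw]
    field_simp
  have hRz := lintegral_rpow_mul_fourier_sq_le hs0 hs1 hhc hhi
    (integrable_riesz_prod hs0 hpc (norm_trigPoly_le S a))
  have hle := norm_integral_riesz_trigPoly_le hs0 hs1 S a
  rw [hsum2] at hle
  have hCS := ofReal_norm_integral_mul_conj_sq_le (s := s) hGm (continuous_fourier hhi).measurable
  rw [← hpair, hsum, norm_mul, Complex.norm_real, Complex.norm_real, Real.norm_eq_abs,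
    Real.norm_eq_abs, abs_of_pos pi_pos, abs_of_nonneg hA0] at hCS
  set X := ∫⁻ ξ, ENNReal.ofReal (|ξ| ^ s *
        ‖impFT (confVec (((1 - s : ℝ) : ℂ) + 1) (derivProfile ((1 - s : ℝ) : ℂ) k k')) ξ‖ ^ 2)
  have hR0 := rieszConst_pos hs1
  rcases hA0.eq_or_lt with hz | hpos
  · rw [← hz]
    simp
  have hfin : ENNReal.ofReal ((π * A) ^ 2) ≤
      X * ENNReal.ofReal (rieszConst s * (π * ‖rieszCoeff s 0‖ * A)) :=
    hCS.trans (mul_le_mul_right (hRz.trans (ENNReal.ofReal_le_ofReal (by gcongr))) _)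
  have hpA : 0 < π ^ 2 * A := by positivity
  rw [show (π * A) ^ 2 = A * (π ^ 2 * A) by ring, ENNReal.ofReal_mul hA0,
    show rieszConst s * (π * ‖rieszCoeff s 0‖ * A) = dualityConst s * (π ^ 2 * A) by
      rw [dualityConst]
      field_simp, ENNReal.ofReal_mul' hpA.le, ← mul_assoc] at hfin
  rw [mul_comm (ENNReal.ofReal (dualityConst s))]
  exact (ENNReal.mul_le_mul_iff_left (by simpa using hpA) ENNReal.ofReal_ne_top).1 hfin

theorem lintegral_inv_one_add_sq : ∫⁻ x : ℝ, ENNReal.ofReal (1 + x ^ 2)⁻¹ = ENNReal.ofReal π := by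
  rw [← ofReal_integral_eq_lintegral_ofReal integrable_inv_one_add_sq
    (Eventually.of_forall fun x => by positivity), integral_univ_inv_one_add_sq]

theorem lintegral_norm_confVec_sq_le {a : ℂ} (ha : 1 ≤ a.re) {k : ℝ → ℂ} {B : ℝ}
    (hB : ∀ t, ‖k t‖ ≤ B) :
    ∫⁻ x, ENNReal.ofReal (‖confVec a k x‖ ^ 2) ≤ ENNReal.ofReal (π * B ^ 2) := by
  have hB0 : 0 ≤ B := (norm_nonneg _).trans (hB 0)
  rw [mul_comm, ENNReal.ofReal_mul (by positivity), ← lintegral_inv_one_add_sq,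
    ← lintegral_const_mul' _ _ ENNReal.ofReal_ne_top]
  refine lintegral_mono fun x => ?_
  rw [← ENNReal.ofReal_mul (by positivity)]
  refine ENNReal.ofReal_le_ofReal ?_
  have h1 : ((1 + x ^ 2) ^ (-a.re / 2)) ^ 2 ≤ (1 + x ^ 2)⁻¹ := by
    rw [← Real.rpow_natCast, ← Real.rpow_mul (by positivity), ← Real.rpow_neg_one]
    refine Real.rpow_le_rpow_of_exponent_le (by nlinarith [sq_nonneg x]) ?_
    push_cast
    linarith
  calc _ ≤ (B * (1 + x ^ 2) ^ (-a.re / 2)) ^ 2 := by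
        gcongr
        exact norm_confVec_le a hB x
    _ = B ^ 2 * ((1 + x ^ 2) ^ (-a.re / 2)) ^ 2 := by ring
    _ ≤ _ := by gcongr

section ImproperTransform

variable {a : ℂ} {k k' : ℝ → ℂ} {B B' : ℝ}

theorem lintegral_impFT_sq_le (ha : 1 ≤ a.re) (hk : ∀ t, HasDerivAt k (k' t) t)
    (hk'c : Continuous k') (hB : ∀ t, ‖k t‖ ≤ B) (hB' : ∀ t, ‖k' t‖ ≤ B') :
    ∫⁻ ξ, ENNReal.ofReal (‖impFT (confVec (a + 1) (derivProfile a k k')) ξ‖ ^ 2) ≤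
      ENNReal.ofReal (π * B ^ 2) := by
  have hkc : Continuous k := continuous_iff_continuousAt.2 fun t => (hk t).continuousAt
  set f : ℕ → ℝ → ℂ := fun n => (Ioc (-((n : ℝ) + 1)) ((n : ℝ) + 1)).indicator (confVec a k) with hf
  have hfi : ∀ n, Integrable (f n) := fun n =>
    (integrable_indicator_iff measurableSet_Ioc).2 ((continuous_confVec a hkc).integrableOn_Ioc)
  have hatTop : Tendsto (fun n : ℕ => (n : ℝ) + 1) atTop atTop :=
    tendsto_atTop_add_const_right _ _ tendsto_natCast_atTop_atTop
  have hbd : ∀ n, ∫⁻ ξ, ENNReal.ofReal (‖𝓕 (f n) ξ‖ ^ 2) ≤ ENNReal.ofReal (π * B ^ 2) := fun n => by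
    refine (lintegral_fourier_sq_le (hfi n)).trans
      (le_trans (lintegral_mono fun x => ENNReal.ofReal_le_ofReal ?_)
        (lintegral_norm_confVec_sq_le ha hB))
    gcongr
    exact norm_indicator_le_norm_self _ _
  calc _ = ∫⁻ ξ, liminf (fun n => ENNReal.ofReal (‖𝓕 (f n) ξ‖ ^ 2)) atTop := by
        refine lintegral_congr_ae ?_
        filter_upwards [compl_mem_ae_iff.2 (measure_singleton (0 : ℝ))] with ξ hξ
        have h1 := isImpFT_confVec (a := a) (by linarith) hk hk'c hB hB' (show ξ ≠ 0 from hξ)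
        have h2 : Tendsto (fun n => 𝓕 (f n) ξ) atTop
            (nhds (impFT (confVec (a + 1) (derivProfile a k k')) ξ)) := by
          refine (h1.comp hatTop).congr fun n => ?_
          rw [hf]
          simp only
          rw [fourier_indicator _ measurableSet_Ioc]
          rfl
        exact (ENNReal.tendsto_ofReal (h2.norm.pow 2)).liminf_eq.symm
    _ ≤ liminf (fun n => ∫⁻ ξ, ENNReal.ofReal (‖𝓕 (f n) ξ‖ ^ 2)) atTop :=
        lintegral_liminf_le fun n => by
          have := (continuous_fourier (hfi n)).measurable
          fun_prop
    _ ≤ _ := by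
        refine liminf_le_of_le (by isBoundedDefault) fun b hb => ?_
        obtain ⟨n, hn⟩ := hb.exists
        exact hn.trans (hbd n)

theorem lintegral_sq_mul_impFT_sq_le (ha : 1 ≤ a.re) (hkc : Continuous k) (hk'c : Continuous k')
    (hB : ∀ t, ‖k t‖ ≤ B) (hB' : ∀ t, ‖k' t‖ ≤ B') :
    ∫⁻ ξ, ENNReal.ofReal (ξ ^ 2 * ‖impFT (confVec (a + 1) (derivProfile a k k')) ξ‖ ^ 2) ≤
      ENNReal.ofReal (π * (‖a‖ * B + B') ^ 2) := by
  have hre : (a + 1).re = a.re + 1 := by simp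
  have hpB := norm_derivProfile_le a hB hB'
  have hint := integrable_confVec (a := a + 1) (by rw [hre]; linarith)
    (continuous_derivProfile a hkc hk'c) hpB
  refine le_trans (lintegral_mono fun ξ => ENNReal.ofReal_le_ofReal ?_)
    ((lintegral_fourier_sq_le hint).trans (lintegral_norm_confVec_sq_le (by rw [hre]; linarith) hpB))
  rw [impFT, norm_div, norm_two_pi_I_mul]
  rcases eq_or_ne ξ 0 with rfl | hξ
  · simp
  have h1 : 1 ≤ (2 * π) ^ 2 := by
    have := pi_gt_three
    nlinarith
  have h2 : ξ ^ 2 * (‖𝓕 (confVec (a + 1) (derivProfile a k k')) ξ‖ / (2 * π * |ξ|)) ^ 2 =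
      ‖𝓕 (confVec (a + 1) (derivProfile a k k')) ξ‖ ^ 2 / (2 * π) ^ 2 := by
    rw [← sq_abs ξ]
    have := abs_pos.2 hξ
    field_simp
  rw [h2]
  exact div_le_self (by positivity) h1

end ImproperTransform

theorem abs_rpow_le_add {s M : ℝ} (hs0 : 0 < s) (hs1 : s < 1) (hM : 0 < M) (ξ : ℝ) :
    |ξ| ^ s ≤ M ^ s + M ^ (s - 2) * ξ ^ 2 := by
  rcases le_total |ξ| M with h | h
  · have := Real.rpow_le_rpow (abs_nonneg ξ) h hs0.le
    have : 0 ≤ M ^ (s - 2) * ξ ^ 2 := by positivity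
    linarith
  · have hξ : 0 < |ξ| := hM.trans_le h
    have h1 : |ξ| ^ s = |ξ| ^ (s - 2) * ξ ^ 2 := by
      rw [← sq_abs, ← Real.rpow_natCast, ← Real.rpow_add hξ]
      norm_num
    have h2 : |ξ| ^ (s - 2) ≤ M ^ (s - 2) := Real.rpow_le_rpow_of_nonpos hM h (by linarith)
    rw [h1]
    have : |ξ| ^ (s - 2) * ξ ^ 2 ≤ M ^ (s - 2) * ξ ^ 2 := by gcongr
    have : 0 ≤ M ^ s := by positivity
    linarith

/-- The improper Fourier transform of the weight vector of frequency `m`. -/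
def modeFT (a : ℂ) (m : ℤ) : ℝ → ℂ :=
  impFT (confVec (a + 1) (derivProfile a (circMode m) fun t => 2 * m * Complex.I * circMode m t))

theorem norm_deriv_circMode (m : ℤ) (t : ℝ) :
    ‖2 * m * Complex.I * circMode m t‖ = 2 * |(m : ℝ)| := by
  rw [norm_mul, norm_circMode]
  simp

theorem continuous_deriv_circMode (m : ℤ) :
    Continuous fun t => 2 * m * Complex.I * circMode m t :=
  continuous_const.mul (continuous_circMode m)

theorem integrable_mode {a : ℂ} (ha : 1 ≤ a.re) (m : ℤ) :
    Integrable (confVec (a + 1)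
      (derivProfile a (circMode m) fun t => 2 * m * Complex.I * circMode m t)) :=
  integrable_confVec (by rw [Complex.add_re, Complex.one_re]; linarith)
    (continuous_derivProfile a (continuous_circMode m) (continuous_deriv_circMode m))
    (norm_derivProfile_le a (fun t => (norm_circMode m t).le) fun t => (norm_deriv_circMode m t).le)

theorem measurable_modeFT {a : ℂ} (ha : 1 ≤ a.re) (m : ℤ) : Measurable (modeFT a m) :=
  measurable_impFT (integrable_mode ha m)

theorem lintegral_rpow_mul_modeFT_sq_le {s : ℝ} (hs0 : 0 < s) (hs1 : s < 1) {a : ℂ}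
    (ha : 1 ≤ a.re) (m : ℤ) :
    ∫⁻ ξ, ENNReal.ofReal (|ξ| ^ s * ‖modeFT a m ξ‖ ^ 2) ≤
      ENNReal.ofReal (π * (1 + (‖a‖ + 2) ^ 2) * modeWeight s m) := by
  have hVm := measurable_modeFT ha m
  have h1 := lintegral_impFT_sq_le ha (hasDerivAt_circMode m) (continuous_deriv_circMode m)
    (fun t => (norm_circMode m t).le) fun t => (norm_deriv_circMode m t).le
  have h2 := lintegral_sq_mul_impFT_sq_le ha (continuous_circMode m) (continuous_deriv_circMode m)
    (fun t => (norm_circMode m t).le) fun t => (norm_deriv_circMode m t).le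
  rw [← modeFT] at h1 h2
  set M : ℝ := 1 + |(m : ℝ)| with hM
  have hM0 : 0 < M := by positivity
  calc _ ≤ ∫⁻ ξ, (ENNReal.ofReal (M ^ s) * ENNReal.ofReal (‖modeFT a m ξ‖ ^ 2) +
          ENNReal.ofReal (M ^ (s - 2)) * ENNReal.ofReal (ξ ^ 2 * ‖modeFT a m ξ‖ ^ 2)) := by
        refine lintegral_mono fun ξ => ?_
        rw [← ENNReal.ofReal_mul (by positivity), ← ENNReal.ofReal_mul (by positivity),
          ← ENNReal.ofReal_add (by positivity) (by positivity)]
        refine ENNReal.ofReal_le_ofReal ?_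
        rw [← mul_assoc, ← add_mul]
        gcongr
        exact abs_rpow_le_add hs0 hs1 hM0 ξ
    _ ≤ ENNReal.ofReal (M ^ s) * ENNReal.ofReal (π * 1 ^ 2) +
          ENNReal.ofReal (M ^ (s - 2)) * ENNReal.ofReal (π * (‖a‖ * 1 + 2 * |(m : ℝ)|) ^ 2) := by
        rw [lintegral_add_left (by fun_prop), lintegral_const_mul' _ _ ENNReal.ofReal_ne_top,
          lintegral_const_mul' _ _ ENNReal.ofReal_ne_top]
        gcongr
    _ ≤ _ := by
        rw [← ENNReal.ofReal_mul (by positivity), ← ENNReal.ofReal_mul (by positivity),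
          ← ENNReal.ofReal_add (by positivity) (by positivity)]
        refine ENNReal.ofReal_le_ofReal ?_
        have h3 : ‖a‖ * 1 + 2 * |(m : ℝ)| ≤ (‖a‖ + 2) * M := by
          rw [hM]
          nlinarith [norm_nonneg a, abs_nonneg (m : ℝ), mul_nonneg (norm_nonneg a) (abs_nonneg (m : ℝ))]
        have h4 : M ^ (s - 2) * M ^ 2 = M ^ s := by
          rw [← Real.rpow_natCast, ← Real.rpow_add hM0]
          norm_num
        calc _ ≤ M ^ s * (π * 1 ^ 2) + M ^ (s - 2) * (π * ((‖a‖ + 2) * M) ^ 2) := by gcongr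
          _ = M ^ s * π + (M ^ (s - 2) * M ^ 2) * (π * (‖a‖ + 2) ^ 2) := by ring
          _ = _ := by
            rw [h4, modeWeight, ← hM]
            ring

theorem norm_modeCoeff_le {k : ℝ → ℂ} {B : ℝ} (hB : ∀ t, ‖k t‖ ≤ B) (m : ℤ) :
    ‖modeCoeff k m‖ ≤ B := by
  have h := intervalIntegral.norm_integral_le_of_norm_le_const (a := -(π / 2)) (b := π / 2)
    (f := fun t => k t * conj (circMode m t)) (C := B) fun t _ => by
      rw [norm_mul, RCLike.norm_conj, norm_circMode, mul_one]
      exact hB t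
  rw [show |π / 2 - -(π / 2)| = π by rw [sub_neg_eq_add, add_halves, abs_of_pos pi_pos]] at h
  rw [modeCoeff, norm_mul, norm_inv, Complex.norm_real, Real.norm_of_nonneg pi_pos.le,
    inv_mul_le_iff₀ pi_pos, mul_comm]
  exact h

theorem modeCoeff_deriv {k k' : ℝ → ℂ} (hper : Function.Periodic k π)
    (hk : ∀ t, HasDerivAt k (k' t) t) (hk'c : Continuous k') (m : ℤ) :
    modeCoeff k' m = 2 * m * Complex.I * modeCoeff k m := by
  have hd : ∀ t, HasDerivAt (fun t => conj (circMode m t))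
      (-(2 * m * Complex.I) * conj (circMode m t)) t := fun t => by
    simp only [conj_circMode]
    refine (hasDerivAt_circMode (-m) t).congr_deriv ?_
    push_cast
    ring
  have hkc : Continuous k := continuous_iff_continuousAt.2 fun t => (hk t).continuousAt
  have hcc : Continuous fun t => conj (circMode m t) :=
    Complex.continuous_conj.comp (continuous_circMode m)
  have hI := intervalIntegral.integral_mul_deriv_eq_deriv_mul (a := -(π / 2)) (b := π / 2)
    (fun t _ => hd t) (fun t _ => hk t)
    ((continuous_const.mul hcc).intervalIntegrable _ _) (hk'c.intervalIntegrable _ _)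
  have h1 : k (π / 2) = k (-(π / 2)) := by
    rw [← hper (-(π / 2))]; congr 1; ring
  have h2 : conj (circMode m (π / 2)) = conj (circMode m (-(π / 2))) := by
    rw [← circMode_periodic m (-(π / 2))]; congr 2; ring
  rw [h1, h2, sub_self, zero_sub, ← intervalIntegral.integral_neg] at hI
  rw [modeCoeff, modeCoeff, mul_left_comm,
    ← intervalIntegral.integral_const_mul (2 * m * Complex.I : ℂ)]
  congr 1
  simp only [mul_comm (k' _)]
  rw [hI]
  refine intervalIntegral.integral_congr fun t _ => ?_
  ring

theorem summable_norm_modeCoeff {k k' k'' : ℝ → ℂ} (hper : Function.Periodic k π)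
    (hper' : Function.Periodic k' π) (hk : ∀ t, HasDerivAt k (k' t) t)
    (hk' : ∀ t, HasDerivAt k' (k'' t) t) (hk''c : Continuous k'') {B : ℝ}
    (hB : ∀ t, ‖k'' t‖ ≤ B) : Summable fun m => ‖modeCoeff k m‖ := by
  have hk'c : Continuous k' := continuous_iff_continuousAt.2 fun t => (hk' t).continuousAt
  have hs : Summable fun m : ℤ => B * (1 / (m : ℝ) ^ 2) :=
    ((Real.summable_one_div_int_pow (p := 2)).2 (by norm_num)).mul_left B
  refine hs.of_norm_bounded_eventually ?_
  filter_upwards [(finite_singleton (0 : ℤ)).compl_mem_cofinite] with m hm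
  replace hm : m ≠ 0 := hm
  have h := norm_modeCoeff_le hB m
  rw [modeCoeff_deriv hper' hk' hk''c, modeCoeff_deriv hper hk hk'c] at h
  have hm' : 0 < (m : ℝ) ^ 2 := by positivity
  simp only [norm_mul, Complex.norm_I, Complex.norm_ofNat, mul_one, Complex.norm_intCast] at h
  rw [norm_norm, mul_one_div, le_div_iff₀ hm', ← sq_abs]
  nlinarith [mul_nonneg (norm_nonneg (modeCoeff k m)) (sq_nonneg |(m : ℝ)|)]

instance fact_pi_pos : Fact (0 < π) := ⟨pi_pos⟩

theorem hasSum_modeCoeff {k : ℝ → ℂ} (hper : Function.Periodic k π) (hkc : Continuous k)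
    (hs : Summable fun m => ‖modeCoeff k m‖) (t : ℝ) :
    HasSum (fun m => modeCoeff k m * circMode m t) (k t) := by
  have hf : ∀ (n : ℤ) (x : ℝ), fourier (T := π) n (x : AddCircle π) = circMode n x := fun n x => by
    rw [fourier_coe_apply, circMode]
    congr 1
    have : (π : ℂ) ≠ 0 := by exact_mod_cast pi_ne_zero
    field_simp
  let f : C(AddCircle π, ℂ) := ⟨hper.lift, hkc.quotient_liftOn' _⟩
  have hft : ∀ x : ℝ, f (x : AddCircle π) = k x := fun x => hper.lift_coe x
  have hc : ∀ m, fourierCoeff f m = modeCoeff k m := fun m => by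
    rw [fourierCoeff_eq_intervalIntegral _ _ (-(π / 2)), modeCoeff]
    rw [show -(π / 2) + π = π / 2 by ring]
    simp only [hft, hf, conj_circMode, smul_eq_mul, Complex.real_smul]
    push_cast
    rw [one_div]
    simp only [mul_comm (k _)]
  have h := has_pointwise_sum_fourier_series_of_summable (f := f)
    (by simp only [funext hc]; exact hs.of_norm) (t : AddCircle π)
  simpa only [hc, hf, hft, smul_eq_mul] using h

/-- The symmetric window of frequencies of size at most `N`. -/
def modeWindow (N : ℕ) : Finset ℤ := Finset.Icc (-(N : ℤ)) N

theorem tendsto_modeWindow : Tendsto modeWindow atTop atTop := by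
  refine tendsto_atTop_finset_of_monotone ?_ fun m => ⟨m.natAbs, ?_⟩
  · intro M N h
    have : (M : ℤ) ≤ N := by exact_mod_cast h
    exact Finset.Icc_subset_Icc (by lia) this
  · rw [modeWindow, Finset.mem_Icc]
    lia

theorem tendsto_trigPoly_modeCoeff {k : ℝ → ℂ} (hper : Function.Periodic k π) (hkc : Continuous k)
    (hs : Summable fun m => ‖modeCoeff k m‖) (t : ℝ) :
    Tendsto (fun N => trigPoly (modeWindow N) (modeCoeff k) t) atTop (nhds (k t)) :=
  (hasSum_modeCoeff hper hkc hs t).comp tendsto_modeWindow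

theorem exists_norm_le_of_periodic {k : ℝ → ℂ} (hper : Function.Periodic k π)
    (hkc : Continuous k) : ∃ B, ∀ t, ‖k t‖ ≤ B := by
  obtain ⟨B, hB⟩ := (hper.isBounded_of_continuous pi_ne_zero hkc).exists_norm_le
  exact ⟨B, fun t => hB _ (mem_range_self t)⟩

theorem periodic_of_hasDerivAt {k k' : ℝ → ℂ} (hper : Function.Periodic k π)
    (hk : ∀ t, HasDerivAt k (k' t) t) : Function.Periodic k' π := fun t => by
  have h := (hk (t + π)).comp_add_const t π
  rw [show (fun x => k (x + π)) = k from funext hper] at h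
  exact h.unique (hk t)

theorem cos_arctan_ne_zero (x : ℝ) : Real.cos (Real.arctan x) ≠ 0 := (Real.cos_arctan_pos x).ne'

theorem apply_arctan_rotate {k : ℝ → ℂ} (hper : Function.Periodic k π) {x θ : ℝ}
    (hd : Real.cos θ - x * Real.sin θ ≠ 0) :
    k (Real.arctan ((x * Real.cos θ + Real.sin θ) / (Real.cos θ - x * Real.sin θ))) =
      k (Real.arctan x + θ) := by
  set y := (x * Real.cos θ + Real.sin θ) / (Real.cos θ - x * Real.sin θ) with hy
  have hsx : Real.sin (Real.arctan x) = x * Real.cos (Real.arctan x) := by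
    conv_rhs => rw [← Real.tan_arctan x]
    rw [Real.arctan_tan (Real.neg_pi_div_two_lt_arctan x) (Real.arctan_lt_pi_div_two x),
      Real.tan_mul_cos (cos_arctan_ne_zero x)]
  have hsy : Real.sin (Real.arctan y) = y * Real.cos (Real.arctan y) := by
    conv_rhs => rw [← Real.tan_arctan y]
    rw [Real.arctan_tan (Real.neg_pi_div_two_lt_arctan y) (Real.arctan_lt_pi_div_two y),
      Real.tan_mul_cos (cos_arctan_ne_zero y)]
  have h0 : Real.sin (Real.arctan y - (Real.arctan x + θ)) = 0 := by
    have hyd : y * (Real.cos θ - x * Real.sin θ) = x * Real.cos θ + Real.sin θ := by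
      rw [hy, div_mul_cancel₀ _ hd]
    rw [Real.sin_sub, Real.sin_add, Real.cos_add, hsy, hsx]
    linear_combination (Real.cos (Real.arctan y) * Real.cos (Real.arctan x)) * hyd
  obtain ⟨n, hn⟩ := Real.sin_eq_zero_iff.1 h0
  rw [show Real.arctan y = Real.arctan x + θ + n * π by linarith, hper.int_mul n]

theorem piPlus_confVec {k : ℝ → ℂ} (hper : Function.Periodic k π) (s : ℂ) {x θ : ℝ}
    (hd : Real.cos θ - x * Real.sin θ ≠ 0) :
    piPlus s θ (confVec (1 + s) k) x = confVec (1 + s) (fun t => k (t + θ)) x := by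
  rw [piPlus, confVec, confVec, apply_arctan_rotate hper hd, ← mul_assoc]
  congr 1
  set d := Real.cos θ - x * Real.sin θ with hdd
  set y := (x * Real.cos θ + Real.sin θ) / d with hy
  have hda : 0 < |d| := abs_pos.2 hd
  have h1 : (1 + x ^ 2 : ℝ) = (1 + y ^ 2) * (|d| * |d|) := by
    rw [abs_mul_abs_self, hy, div_pow]
    have := Real.sin_sq_add_cos_sq θ
    field_simp
    rw [hdd]
    linear_combination (-(1 + x ^ 2)) * this
  rw [h1]
  push_cast
  rw [show (1 + (y : ℂ) ^ 2) = ((1 + y ^ 2 : ℝ) : ℂ) by push_cast; rfl, ← Complex.ofReal_mul,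
    Complex.mul_cpow_ofReal_nonneg (by positivity) (by positivity), Complex.ofReal_mul,
    Complex.mul_cpow_ofReal_nonneg hda.le hda.le, mul_comm,
    ← Complex.cpow_add _ _ (by exact_mod_cast hda.ne')]
  congr 2
  ring

theorem ae_cos_sub_mul_sin_ne_zero (θ : ℝ) : ∀ᵐ x : ℝ, Real.cos θ - x * Real.sin θ ≠ 0 := by
  rw [ae_iff]
  refine Set.Subsingleton.measure_zero (fun x hx y hy => ?_) _
  simp only [not_not, mem_ofPred_eq] at hx hy
  by_cases hs : Real.sin θ = 0
  · have := Real.sin_sq_add_cos_sq θ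
    simp [hs] at hx this
    simp [hx] at this
  · exact mul_right_cancel₀ hs (by linarith)

theorem IsImpFT.congr_ae {f g : ℝ → ℂ} {ξ : ℝ} {z : ℂ} (h : IsImpFT f ξ z) (hfg : f =ᵐ[volume] g) :
    IsImpFT g ξ z :=
  h.congr fun _ => integral_congr_ae (ae_restrict_of_ae (hfg.mono fun x hx => by
    simp only [hx]))

theorem rpow_mul_confVec (a b : ℂ) (k : ℝ → ℂ) (x : ℝ) :
    ((1 + x ^ 2 : ℝ) : ℂ) ^ (b / 2) * confVec a k x = confVec (a - b) k x := by
  have h : (1 + x ^ 2 : ℝ) ≠ 0 := by positivity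
  rw [confVec, confVec, ← mul_assoc, ← Complex.cpow_add _ _ (by exact_mod_cast h)]
  congr 2
  ring

/-- The Fourier transform of the rotated vector with profile `k`. -/
def rotFT (a : ℂ) (k k' : ℝ → ℂ) (θ : ℝ) : ℝ → ℂ :=
  impFT (confVec (a + 1) (derivProfile a (fun t => k (t + θ)) fun t => k' (t + θ)))

theorem rotFT_trigPoly {a : ℂ} (ha : 1 ≤ a.re) (S : Finset ℤ) (c : ℤ → ℂ) (θ ξ : ℝ) :
    rotFT a (trigPoly S c) (trigPoly S fun m => 2 * m * Complex.I * c m) θ ξ =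
      trigPoly S (fun m => c m * modeFT a m ξ) θ := by
  have hx : ∀ x, confVec (a + 1) (derivProfile a (fun t => trigPoly S c (t + θ))
      fun t => trigPoly S (fun m => 2 * m * Complex.I * c m) (t + θ)) x * ftKernel ξ x =
      ∑ m ∈ S, (c m * circMode m θ) * (confVec (a + 1) (derivProfile a (circMode m)
        fun t => 2 * m * Complex.I * circMode m t) x * ftKernel ξ x) := fun x => by
    simp only [confVec, derivProfile, trigPoly, circMode_add, Finset.mul_sum, Finset.sum_mul,
      ← Finset.sum_add_distrib]
    exact Finset.sum_congr rfl fun m _ => by ring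
  have hi : ∀ m, Integrable fun x => confVec (a + 1) (derivProfile a (circMode m)
        fun t => 2 * m * Complex.I * circMode m t) x * ftKernel ξ x := fun m => by
    refine (integrable_mode ha m).norm.mono' ((integrable_mode ha m).aestronglyMeasurable.mul
      (continuous_ftKernel ξ).aestronglyMeasurable) (Eventually.of_forall fun x => ?_)
    rw [norm_mul, norm_ftKernel, mul_one]
  rw [rotFT, impFT, fourier_eq_integral_ftKernel]
  simp only [hx]
  rw [integral_finsetSum _ fun m _ => (hi m).const_mul _, Finset.sum_div, trigPoly]
  refine Finset.sum_congr rfl fun m _ => ?_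
  rw [integral_const_mul, modeFT, impFT, fourier_eq_integral_ftKernel]
  ring

theorem tendsto_impFT_confVec {a : ℂ} (ha : 1 < a.re) {K : ℕ → ℝ → ℂ} {k : ℝ → ℂ} {B : ℝ}
    (hK : ∀ N, Continuous (K N)) (hB : ∀ N t, ‖K N t‖ ≤ B)
    (hlim : ∀ t, Tendsto (fun N => K N t) atTop (nhds (k t))) (ξ : ℝ) :
    Tendsto (fun N => impFT (confVec a (K N)) ξ) atTop (nhds (impFT (confVec a k) ξ)) := by
  simp only [impFT, fourier_eq_integral_ftKernel]
  refine Tendsto.div_const (tendsto_integral_of_dominated_convergence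
    (fun x => B * (1 + x ^ 2) ^ (-a.re / 2))
    (fun N => ((continuous_confVec a (hK N)).mul (continuous_ftKernel ξ)).aestronglyMeasurable)
    ((integrable_one_add_sq_rpow ha).const_mul B)
    (fun N => Eventually.of_forall fun x => ?_) (Eventually.of_forall fun x => ?_)) _
  · rw [Pi.mul_apply, norm_mul, norm_ftKernel, mul_one]
    exact norm_confVec_le a (hB N) x
  · exact ((hlim _).const_mul _).mul_const _

theorem tendsto_rotFT {a : ℂ} (ha : 1 ≤ a.re) {K K' : ℕ → ℝ → ℂ} {k k' : ℝ → ℂ} {B B' : ℝ}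
    (hK : ∀ N, Continuous (K N)) (hK' : ∀ N, Continuous (K' N)) (hB : ∀ N t, ‖K N t‖ ≤ B)
    (hB' : ∀ N t, ‖K' N t‖ ≤ B') (hlim : ∀ t, Tendsto (fun N => K N t) atTop (nhds (k t)))
    (hlim' : ∀ t, Tendsto (fun N => K' N t) atTop (nhds (k' t))) (θ ξ : ℝ) :
    Tendsto (fun N => rotFT a (K N) (K' N) θ ξ) atTop (nhds (rotFT a k k' θ ξ)) := by
  have hshift : Continuous fun t : ℝ => t + θ := by fun_prop
  refine tendsto_impFT_confVec (B := ‖a‖ * B + B') (by simp; linarith)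
    (fun N => continuous_derivProfile a ((hK N).comp hshift) ((hK' N).comp hshift))
    (fun N => norm_derivProfile_le a (fun t => hB N _) fun t => hB' N _) (fun t => ?_) ξ
  exact ((hlim _).const_mul _).add ((hlim' _).const_mul _)

theorem lintegral_norm_trigPoly_sq (S : Finset ℤ) (b : ℤ → ℂ) :
    ∫⁻ θ in Ioc (0:ℝ) (2 * π), ENNReal.ofReal (‖trigPoly S b θ‖ ^ 2) =
      ENNReal.ofReal (2 * π * ∑ m ∈ S, ‖b m‖ ^ 2) := by
  have hc : Continuous fun θ => ‖trigPoly S b θ‖ ^ 2 := (continuous_trigPoly S b).norm.pow 2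
  rw [← ofReal_integral_eq_lintegral_ofReal hc.integrableOn_Ioc
    (Eventually.of_forall fun θ => by positivity)]
  congr 1
  have h := integral_trigPoly_mul_conj S b b 0 2
  simp only [Complex.mul_conj, Complex.normSq_eq_norm_sq] at h
  rw [intervalIntegral.integral_ofReal, ← Complex.ofReal_sum, ← Complex.ofReal_mul,
    Complex.ofReal_inj, intervalIntegral.integral_of_le (by positivity), zero_add] at h
  exact_mod_cast h

theorem measurable_rotate_trigPoly {a : ℂ} (ha : 1 ≤ a.re) (s : ℝ) (S : Finset ℤ) (c : ℤ → ℂ) :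
    Measurable (Function.uncurry fun θ ξ : ℝ =>
      ENNReal.ofReal (|ξ| ^ s * ‖trigPoly S (fun m => c m * modeFT a m ξ) θ‖ ^ 2)) := by
  refine ENNReal.measurable_ofReal.comp ?_
  refine Measurable.mul (by fun_prop) (Measurable.pow_const (Measurable.norm ?_) 2)
  simp only [trigPoly]
  refine Finset.measurable_sum _ fun m _ => ?_
  exact (((measurable_modeFT ha m).comp measurable_snd).const_mul _).mul
    ((continuous_circMode m).measurable.comp measurable_fst)

theorem lintegral_rotate_trigPoly_le {s : ℝ} (hs0 : 0 < s) (hs1 : s < 1) {a : ℂ} (ha : 1 ≤ a.re)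
    (S : Finset ℤ) (c : ℤ → ℂ) :
    ∫⁻ θ in Ioc (0:ℝ) (2 * π), ∫⁻ ξ : ℝ,
        ENNReal.ofReal (|ξ| ^ s * ‖trigPoly S (fun m => c m * modeFT a m ξ) θ‖ ^ 2) ≤
      ENNReal.ofReal (2 * π * (π * (1 + (‖a‖ + 2) ^ 2))) *
        ENNReal.ofReal (∑ m ∈ S, ‖c m‖ ^ 2 * modeWeight s m) := by
  rw [lintegral_lintegral_swap (measurable_rotate_trigPoly ha s S c).aemeasurable]
  have hin : ∀ ξ : ℝ, ∫⁻ θ in Ioc (0:ℝ) (2 * π),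
      ENNReal.ofReal (|ξ| ^ s * ‖trigPoly S (fun m => c m * modeFT a m ξ) θ‖ ^ 2) =
      ∑ m ∈ S, ENNReal.ofReal (2 * π * ‖c m‖ ^ 2) *
        ENNReal.ofReal (|ξ| ^ s * ‖modeFT a m ξ‖ ^ 2) := fun ξ => by
    have hξ : 0 ≤ |ξ| ^ s := by positivity
    simp only [ENNReal.ofReal_mul hξ]
    rw [lintegral_const_mul' _ _ ENNReal.ofReal_ne_top, lintegral_norm_trigPoly_sq,
      ← ENNReal.ofReal_mul hξ]
    simp only [← ENNReal.ofReal_mul hξ]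
    simp only [← ENNReal.ofReal_mul (show 0 ≤ 2 * π * ‖c _‖ ^ 2 by positivity)]
    rw [← ENNReal.ofReal_sum_of_nonneg fun m _ => by positivity]
    congr 1
    simp only [Finset.mul_sum, norm_mul]
    exact Finset.sum_congr rfl fun m _ => by ring
  simp only [hin]
  rw [lintegral_finsetSum' _ fun m _ => ?_]
  · rw [ENNReal.ofReal_sum_of_nonneg fun m _ => mul_nonneg (by positivity) (modeWeight_pos s m).le,
      Finset.mul_sum]
    refine Finset.sum_le_sum fun m _ => ?_
    rw [lintegral_const_mul' _ _ ENNReal.ofReal_ne_top]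
    refine (mul_le_mul_right (lintegral_rpow_mul_modeFT_sq_le hs0 hs1 ha m) _).trans_eq ?_
    rw [← ENNReal.ofReal_mul (by positivity), ← ENNReal.ofReal_mul (by positivity)]
    congr 1
    ring
  · have := measurable_modeFT ha m
    fun_prop

theorem norm_trigPoly_modeCoeff_le {k : ℝ → ℂ} (hs : Summable fun m => ‖modeCoeff k m‖) (N : ℕ)
    (t : ℝ) : ‖trigPoly (modeWindow N) (modeCoeff k) t‖ ≤ ∑' m, ‖modeCoeff k m‖ :=
  (norm_trigPoly_le _ _ t).trans (hs.sum_le_tsum _ fun _ _ => norm_nonneg _)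

theorem lintegral_rotFT_le {s : ℝ} (hs0 : 0 < s) (hs1 : s < 1) {a : ℂ} (ha : 1 ≤ a.re)
    {k k₁ k₂ k₃ : ℝ → ℂ} (hper : Function.Periodic k π) (hk : ∀ t, HasDerivAt k (k₁ t) t)
    (hk₁ : ∀ t, HasDerivAt k₁ (k₂ t) t) (hk₂ : ∀ t, HasDerivAt k₂ (k₃ t) t)
    (hk₃ : Continuous k₃) :
    ∫⁻ θ in Ioc (0:ℝ) (2 * π), ∫⁻ ξ : ℝ, ENNReal.ofReal (|ξ| ^ s * ‖rotFT a k k₁ θ ξ‖ ^ 2) ≤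
      ENNReal.ofReal (2 * π * (π * (1 + (‖a‖ + 2) ^ 2))) * (ENNReal.ofReal (dualityConst s) *
        ∫⁻ ξ, ENNReal.ofReal (|ξ| ^ s *
          ‖impFT (confVec (((1 - s : ℝ) : ℂ) + 1) (derivProfile ((1 - s : ℝ) : ℂ) k k₁)) ξ‖ ^ 2)) := by
  have hper₁ := periodic_of_hasDerivAt hper hk
  have hper₂ := periodic_of_hasDerivAt hper₁ hk₁
  have hper₃ := periodic_of_hasDerivAt hper₂ hk₂
  have hkc : Continuous k := continuous_iff_continuousAt.2 fun t => (hk t).continuousAt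
  have hk₁c : Continuous k₁ := continuous_iff_continuousAt.2 fun t => (hk₁ t).continuousAt
  have hk₂c : Continuous k₂ := continuous_iff_continuousAt.2 fun t => (hk₂ t).continuousAt
  obtain ⟨B, hB⟩ := exists_norm_le_of_periodic hper hkc
  obtain ⟨B₁, hB₁⟩ := exists_norm_le_of_periodic hper₁ hk₁c
  obtain ⟨B₂, hB₂⟩ := exists_norm_le_of_periodic hper₂ hk₂c
  obtain ⟨B₃, hB₃⟩ := exists_norm_le_of_periodic hper₃ hk₃
  have hsum := summable_norm_modeCoeff hper hper₁ hk hk₁ hk₂c hB₂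
  have hsum₁ := summable_norm_modeCoeff hper₁ hper₂ hk₁ hk₂ hk₃ hB₃
  have hlim : ∀ θ ξ, Tendsto
      (fun N => trigPoly (modeWindow N) (fun m => modeCoeff k m * modeFT a m ξ) θ) atTop
      (nhds (rotFT a k k₁ θ ξ)) := fun θ ξ => by
    simp only [← rotFT_trigPoly ha, ← modeCoeff_deriv hper hk hk₁c]
    exact tendsto_rotFT ha (fun N => continuous_trigPoly _ _) (fun N => continuous_trigPoly _ _)
      (norm_trigPoly_modeCoeff_le hsum) (norm_trigPoly_modeCoeff_le hsum₁)
      (tendsto_trigPoly_modeCoeff hper hkc hsum) (tendsto_trigPoly_modeCoeff hper₁ hk₁c hsum₁) θ ξ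
  have hmeas : ∀ N, Measurable (Function.uncurry fun θ ξ : ℝ => ENNReal.ofReal (|ξ| ^ s *
      ‖trigPoly (modeWindow N) (fun m => modeCoeff k m * modeFT a m ξ) θ‖ ^ 2)) := fun N =>
    measurable_rotate_trigPoly ha s _ _
  calc _ = ∫⁻ θ in Ioc (0:ℝ) (2 * π), ∫⁻ ξ : ℝ, liminf (fun N => ENNReal.ofReal (|ξ| ^ s *
          ‖trigPoly (modeWindow N) (fun m => modeCoeff k m * modeFT a m ξ) θ‖ ^ 2)) atTop := by
        refine lintegral_congr fun θ => lintegral_congr fun ξ => ?_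
        exact ((ENNReal.tendsto_ofReal (((hlim θ ξ).norm.pow 2).const_mul _)).liminf_eq).symm
    _ ≤ ∫⁻ θ in Ioc (0:ℝ) (2 * π), liminf (fun N => ∫⁻ ξ : ℝ, ENNReal.ofReal (|ξ| ^ s *
          ‖trigPoly (modeWindow N) (fun m => modeCoeff k m * modeFT a m ξ) θ‖ ^ 2)) atTop :=
        lintegral_mono fun θ => lintegral_liminf_le fun N => (hmeas N).of_uncurry_left
    _ ≤ liminf (fun N => ∫⁻ θ in Ioc (0:ℝ) (2 * π), ∫⁻ ξ : ℝ, ENNReal.ofReal (|ξ| ^ s *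
          ‖trigPoly (modeWindow N) (fun m => modeCoeff k m * modeFT a m ξ) θ‖ ^ 2)) atTop :=
        lintegral_liminf_le fun N => (hmeas N).lintegral_prod_right
    _ ≤ _ := by
        refine liminf_le_of_le (by isBoundedDefault) fun b hb => ?_
        obtain ⟨N, hN⟩ := hb.exists
        refine hN.trans ((lintegral_rotate_trigPoly_le hs0 hs1 ha _ _).trans ?_)
        exact mul_le_mul_right (sum_modeCoeff_le hs0 hs1 hk hk₁c hB hB₁ _) _

theorem ofReal_rpow_mul_norm_sq (x s : ℝ) (z : ℂ) :
    ENNReal.ofReal (|x| ^ s * ‖z‖ ^ 2) = ENNReal.ofReal (|x| ^ s) * (‖z‖₊ : ℝ≥0∞) ^ 2 := by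
  rw [ENNReal.ofReal_mul (by positivity), ENNReal.ofReal_pow (norm_nonneg z), ofReal_norm]
  rfl

end

/-- for `u ∈ (−1,0)`, `λ ∈ ℝ`, there is `c_u > 0` such that every smooth
vector `v(x) = (1+x²)^{−(1+iλ)/2} g(arccot x)` of `P(iλ,+)^∞` (with `g` smooth and
`π`-periodic, i.e. `g = Φ(e^{2iθ})` for smooth `Φ` on the circle) satisfies
`⫴v⫴²_u ≤ c_u ‖(1+x²)^{(iλ−u)/2} v(x)‖²_{C_u}`, the improper Fourier transforms
existing for `ξ ≠ 0`. -/
theorem stmt15 (u lam : ℝ) (hu : u ∈ Set.Ioo (-1 : ℝ) 0) :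
    ∃ c : ℝ, 0 < c ∧
      ∀ g : ℝ → ℂ, ContDiff ℝ (⊤ : ℕ∞) g → (∀ θ : ℝ, g (θ + Real.pi) = g θ) →
        ∀ v : ℝ → ℂ,
          (v = fun x : ℝ =>
            ((1 + x ^ 2 : ℝ) : ℂ) ^ (-(1 + Complex.I * lam) / 2) * g (arccot x)) →
        ∃ F : ℝ → ℝ → ℂ, ∃ G : ℝ → ℂ,
          (∀ θ : ℝ, ∀ ξ : ℝ, ξ ≠ 0 → IsImpFT (piPlus (Complex.I * lam) θ v) ξ (F θ ξ)) ∧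
          (∀ ξ : ℝ, ξ ≠ 0 →
            IsImpFT (fun x : ℝ =>
              ((1 + x ^ 2 : ℝ) : ℂ) ^ ((Complex.I * lam - u) / 2) * v x) ξ (G ξ)) ∧
          (∫⁻ θ in Ioc (0:ℝ) (2 * π),
              ∫⁻ ξ : ℝ, ENNReal.ofReal (|ξ| ^ (-u)) * (‖F θ ξ‖₊ : ℝ≥0∞) ^ 2)
            ≤ ENNReal.ofReal c *
                (∫⁻ ξ : ℝ, ENNReal.ofReal (|ξ| ^ (-u)) * (‖G ξ‖₊ : ℝ≥0∞) ^ 2) := by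
  obtain ⟨hu1, hu0⟩ := hu
  set a : ℂ := 1 + Complex.I * lam with ha_def
  have ha : a.re = 1 := by simp [a]
  set A : ℝ := 2 * π * (π * (1 + (‖a‖ + 2) ^ 2)) with hA
  have hA0 : 0 < A := by positivity
  refine ⟨A * (max (dualityConst (-u)) 0 + 1), by positivity, fun g hg hgper v hv => ?_⟩
  let k : ℝ → ℂ := fun t => g (π / 2 - t)
  have hkdef : ∀ x, g (arccot x) = k (Real.arctan x) := fun x => rfl
  have hksm : ContDiff ℝ (⊤ : ℕ∞) k := hg.comp (contDiff_const.sub contDiff_id)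
  have hper : Function.Periodic k π := fun t => by
    change g (π / 2 - (t + π)) = g (π / 2 - t)
    rw [← hgper (π / 2 - (t + π))]
    congr 1
    ring
  have hd : ∀ n t, HasDerivAt (iteratedDeriv n k) (iteratedDeriv (n + 1) k t) t := fun n t => by
    rw [iteratedDeriv_succ]
    exact (hksm.differentiable_iteratedDeriv n (by exact_mod_cast WithTop.coe_lt_top n) t).hasDerivAt
  have hk : ∀ t, HasDerivAt k (iteratedDeriv 1 k t) t := by simpa using hd 0
  have hkc : Continuous k := hksm.continuous
  have hk₁c : Continuous (iteratedDeriv 1 k) :=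
    continuous_iff_continuousAt.2 fun t => (hd 1 t).continuousAt
  obtain ⟨B, hB⟩ := exists_norm_le_of_periodic hper hkc
  obtain ⟨B₁, hB₁⟩ := exists_norm_le_of_periodic (periodic_of_hasDerivAt hper hk) hk₁c
  have hv' : v = confVec a k := hv
  refine ⟨rotFT a k (iteratedDeriv 1 k),
    impFT (confVec (((1 - -u : ℝ) : ℂ) + 1) (derivProfile ((1 - -u : ℝ) : ℂ) k (iteratedDeriv 1 k))),
    fun θ ξ hξ => ?_, fun ξ hξ => ?_, ?_⟩
  · have h := isImpFT_confVec (a := a) (by linarith) (fun t => (hk (t + θ)).comp_add_const t θ)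
      (hk₁c.comp (by fun_prop : Continuous fun t : ℝ => t + θ)) (fun t => hB _) (fun t => hB₁ _) hξ
    refine h.congr_ae ?_
    filter_upwards [ae_cos_sub_mul_sin_ne_zero θ] with x hx
    rw [hv', piPlus_confVec hper _ hx]
  · have h := isImpFT_confVec (a := ((1 - -u : ℝ) : ℂ)) (by rw [Complex.ofReal_re]; linarith)
      hk hk₁c hB hB₁ hξ
    refine h.congr_ae (Eventually.of_forall fun x => ?_)
    simp only
    rw [hv', rpow_mul_confVec]
    congr 1
    rw [ha_def]
    push_cast
    ring
  · simp only [← ofReal_rpow_mul_norm_sq]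
    refine (lintegral_rotFT_le (by linarith) (by linarith) ha.ge hper hk (hd 1) (hd 2)
      (continuous_iff_continuousAt.2 fun t => (hd 3 t).continuousAt)).trans ?_
    rw [← hA, ← mul_assoc, ← ENNReal.ofReal_mul hA0.le]
    gcongr
    linarith [le_max_left (dualityConst (-u)) 0]
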